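/- The following ℚ-linear relation holds among multiple polylogarithm values of weight 3 at fourth roots of unity (here i denotes the imaginary unit): 5·Li_{1,2}(−1,−i) = 46·Li_{1,1,1}(i,1,1) − 7·Li_{1,1,1}(−1,−1,i) − 13·Li_{1,1,1}(i,i,i) + 13·Li_{1,2}(−i,i) − Li_{1,1,1}(−i,−1,1) + 25·Li_{1,1,1}(−i,1,1) − 8·Li_{1,1,1}(i,i,−1) + 18·Li_{2,1}(−i,1). -/

import Mathlib

open Filter Topology

/-- `mpvPartial l m` is the finite iterated sum
`∑_{m > k₁ > k₂ > ⋯ > kₙ > 0} ∏ⱼ ζⱼ^{kⱼ} / kⱼ^{sⱼ}`, where `l = [(s₁,ζ₁),…,(sₙ,ζₙ)]`,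
i.e. the partial sum (in the outermost variable `k₁`) of the multiple
polylogarithm series; the inner sums are finite. -/
noncomputable def mpvPartial : List (ℕ × ℂ) → ℕ → ℂ
  | [], _ => 1
  | (s, z) :: t, m => ∑ k ∈ Finset.Ico 1 m, z ^ k / (k : ℂ) ^ s * mpvPartial t k

/-- The multiple polylogarithm value
`Li_{s₁,…,sₙ}(ζ₁,…,ζₙ) = ∑_{k₁>⋯>kₙ>0} ζ₁^{k₁}⋯ζₙ^{kₙ} / (k₁^{s₁}⋯kₙ^{sₙ})`,
encoded by the list `l = [(s₁,ζ₁),…,(sₙ,ζₙ)]`: the limit of the sequence of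
partial sums in the outermost summation variable. -/
noncomputable def Li (l : List (ℕ × ℂ)) : ℂ :=
  limUnder atTop (mpvPartial l)

/-- The set of all multiple polylogarithm values of weight `w` and level `N`:
values `Li_{s₁,…,sₙ}(ζ₁,…,ζₙ)` with all `sⱼ ≥ 1`, all `ζⱼ` being `N`-th roots of
unity, total weight `s₁+⋯+sₙ = w`, and `(s₁,ζ₁) ≠ (1,1)`. -/
def MPVset (w N : ℕ) : Set ℂ :=
  {x | ∃ l : List (ℕ × ℂ),
    (∀ q ∈ l, 0 < q.1 ∧ q.2 ^ N = 1) ∧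
    (l.map Prod.fst).sum = w ∧
    l.head? ≠ some (1, 1) ∧
    x = Li l}

/-- `MPV w N` is the `ℚ`-vector subspace of `ℂ` spanned by all multiple
polylogarithm values of weight `w` and level `N`. -/
noncomputable def MPV (w N : ℕ) : Submodule ℚ ℂ :=
  Submodule.span ℚ (MPVset w N)

/-- The exponents of `l` are positive and its arguments lie in the closed unit disc. -/
def AdmissibleWord (l : List (ℕ × ℂ)) : Prop :=
  ∀ q ∈ l, 0 < q.1 ∧ ‖q.2‖ ≤ 1

/-- The coefficients of the one-variable generating series of a multiple polylogarithm. -/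
noncomputable def mpvCoeff : List (ℕ × ℂ) → ℕ → ℂ
  | [], n => if n = 0 then 1 else 0
  | (s, z) :: t, n => z ^ n / (n : ℂ) ^ s * mpvPartial t n

/-- One plus the harmonic sum over the positive integers below `m`. -/
noncomputable def harmonicMajorant (m : ℕ) : ℝ :=
  1 + ∑ k ∈ Finset.Ico 1 m, 1 / (k : ℝ)

theorem AdmissibleWord.tail {q : ℕ × ℂ} {t : List (ℕ × ℂ)} (h : AdmissibleWord (q :: t)) :
    AdmissibleWord t :=
  fun p hp => h p (List.mem_cons_of_mem _ hp)

theorem AdmissibleWord.head {q : ℕ × ℂ} {t : List (ℕ × ℂ)} (h : AdmissibleWord (q :: t)) :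
    0 < q.1 ∧ ‖q.2‖ ≤ 1 :=
  h q List.mem_cons_self

theorem admissibleWord_nil : AdmissibleWord [] := by
  intro q hq
  simp at hq

theorem AdmissibleWord.cons {s : ℕ} {z : ℂ} {t : List (ℕ × ℂ)} (hs : 0 < s) (hz : ‖z‖ ≤ 1)
    (h : AdmissibleWord t) : AdmissibleWord ((s, z) :: t) := by
  intro q hq
  rcases List.mem_cons.mp hq with rfl | hq
  · exact ⟨hs, hz⟩
  · exact h q hq

theorem mpvCoeff_zero_cons {s : ℕ} (hs : 0 < s) (z : ℂ) (t : List (ℕ × ℂ)) :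
    mpvCoeff ((s, z) :: t) 0 = 0 := by
  simp [mpvCoeff, hs.ne']

theorem mpvPartial_eq_sum_mpvCoeff {l : List (ℕ × ℂ)} (h : AdmissibleWord l) {m : ℕ}
    (hm : 1 ≤ m) : mpvPartial l m = ∑ n ∈ Finset.range m, mpvCoeff l n := by
  rw [Finset.range_eq_Ico, Finset.sum_eq_sum_Ico_succ_bot (by omega)]
  match l with
  | [] =>
    rw [Finset.sum_eq_zero]
    · simp [mpvCoeff, mpvPartial]
    · intro n hn
      have := (Finset.mem_Ico.mp hn).1
      simp only [mpvCoeff]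
      rw [if_neg (by omega)]
  | (s, z) :: t =>
    rw [mpvCoeff_zero_cons h.head.1, zero_add]
    rfl

theorem one_le_harmonicMajorant (m : ℕ) : 1 ≤ harmonicMajorant m := by
  simp only [harmonicMajorant]
  have : 0 ≤ ∑ k ∈ Finset.Ico 1 m, 1 / (k : ℝ) := Finset.sum_nonneg fun _ _ => by positivity
  linarith

theorem harmonicMajorant_mono : Monotone harmonicMajorant := by
  intro a b hab
  have := Finset.sum_le_sum_of_subset_of_nonneg (f := fun k : ℕ => 1 / (k : ℝ))
    (Finset.Ico_subset_Ico_right hab : Finset.Ico 1 a ⊆ Finset.Ico 1 b)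
    fun _ _ _ => by positivity
  simp only [harmonicMajorant]
  linarith

theorem norm_pow_div_natCast_pow_le {z : ℂ} (hz : ‖z‖ ≤ 1) {n r s : ℕ} (hn : 1 ≤ n)
    (hrs : r ≤ s) : ‖z ^ n / (n : ℂ) ^ s‖ ≤ 1 / (n : ℝ) ^ r := by
  have hn' : (1 : ℝ) ≤ n := by exact_mod_cast hn
  rw [norm_div, norm_pow, norm_pow, Complex.norm_natCast]
  exact div_le_div₀ zero_le_one (pow_le_one₀ (norm_nonneg _) hz) (by positivity)
    (pow_le_pow_right₀ hn' hrs)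

theorem norm_mpvPartial_le {l : List (ℕ × ℂ)} (h : AdmissibleWord l) (m : ℕ) :
    ‖mpvPartial l m‖ ≤ harmonicMajorant m ^ l.length := by
  induction l generalizing m with
  | nil => simp [mpvPartial]
  | cons q t ih =>
    obtain ⟨s, z⟩ := q
    obtain ⟨hs, hz⟩ := h.head
    simp only [mpvPartial, List.length_cons]
    calc _ ≤ ∑ k ∈ Finset.Ico 1 m, ‖z ^ k / (k : ℂ) ^ s * mpvPartial t k‖ := norm_sum_le _ _
      _ ≤ ∑ k ∈ Finset.Ico 1 m, 1 / (k : ℝ) * harmonicMajorant m ^ t.length := by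
        refine Finset.sum_le_sum fun k hk => ?_
        obtain ⟨hk1, hkm⟩ := Finset.mem_Ico.mp hk
        rw [norm_mul]
        refine mul_le_mul ?_ ?_ (norm_nonneg _) (by positivity)
        · simpa using norm_pow_div_natCast_pow_le hz hk1 (Nat.succ_le_of_lt hs)
        · refine (ih h.tail k).trans ?_
          have := one_le_harmonicMajorant k
          gcongr
          exact harmonicMajorant_mono hkm.le
      _ = (∑ k ∈ Finset.Ico 1 m, 1 / (k : ℝ)) * harmonicMajorant m ^ t.length := by
        rw [Finset.sum_mul]
      _ ≤ harmonicMajorant m * harmonicMajorant m ^ t.length := by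
        have := one_le_harmonicMajorant m
        gcongr
        simp only [harmonicMajorant]
        linarith
      _ = _ := by ring

theorem norm_mpvCoeff_le {l : List (ℕ × ℂ)} (h : AdmissibleWord l) {n : ℕ} (hn : 1 ≤ n) :
    ‖mpvCoeff l n‖ ≤ harmonicMajorant n ^ l.length / n := by
  have hK := one_le_harmonicMajorant n
  match l with
  | [] =>
    simp only [mpvCoeff]
    rw [if_neg (by omega), norm_zero]
    positivity
  | (s, z) :: t =>
    obtain ⟨hs, hz⟩ := h.head
    simp only [mpvCoeff, List.length_cons]
    rw [norm_mul, mul_comm, div_eq_mul_one_div (harmonicMajorant n ^ _)]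
    refine mul_le_mul ?_ ?_ (norm_nonneg _) (by positivity)
    · refine (norm_mpvPartial_le h.tail n).trans ?_
      exact pow_le_pow_right₀ hK (Nat.le_succ _)
    · simpa using norm_pow_div_natCast_pow_le hz hn (Nat.succ_le_of_lt hs)

theorem exists_harmonicMajorant_pow_le (d : ℕ) :
    ∃ C : ℝ, 0 ≤ C ∧ ∀ m : ℕ, 1 ≤ m → harmonicMajorant m ^ d ≤ C * (m : ℝ) ^ (1 / 2 : ℝ) := by
  set ε : ℝ := 1 / (2 * (d + 1)) with hε
  have hε0 : 0 < ε := by positivity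
  refine ⟨(2 + 1 / ε) ^ d, by positivity, fun m hm => ?_⟩
  have hm' : (1 : ℝ) ≤ m := by exact_mod_cast hm
  have h1 : (1 : ℝ) ≤ (m : ℝ) ^ ε := Real.one_le_rpow hm' hε0.le
  have hK : harmonicMajorant m ≤ (2 + 1 / ε) * (m : ℝ) ^ ε := by
    have h2 : ∑ k ∈ Finset.Ico 1 m, 1 / (k : ℝ) ≤ 1 + Real.log m := by
      have := harmonic_le_one_add_log m
      rw [harmonic_eq_sum_Icc] at this
      push_cast at this
      refine le_trans ?_ this
      simp only [one_div]
      refine Finset.sum_le_sum_of_subset_of_nonneg ?_ fun _ _ _ => by positivity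
      exact Finset.Ico_subset_Icc_self
    have h3 := Real.log_le_rpow_div (Nat.cast_nonneg m) hε0
    simp only [harmonicMajorant]
    have h4 : (m : ℝ) ^ ε / ε = 1 / ε * (m : ℝ) ^ ε := by ring
    linarith [add_mul 2 (1 / ε) ((m : ℝ) ^ ε)]
  calc _ ≤ ((2 + 1 / ε) * (m : ℝ) ^ ε) ^ d := by
        have := one_le_harmonicMajorant m
        gcongr
    _ = (2 + 1 / ε) ^ d * (m : ℝ) ^ (ε * d) := by
        rw [mul_pow, ← Real.rpow_natCast ((m : ℝ) ^ ε), ← Real.rpow_mul (by positivity)]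
    _ ≤ _ := by
        gcongr
        rw [hε, div_mul_eq_mul_div, div_le_div_iff₀ (by positivity) (by positivity)]
        linarith

theorem tendsto_harmonicMajorant_pow_div (d : ℕ) :
    Tendsto (fun m : ℕ => harmonicMajorant m ^ d / m) atTop (𝓝 0) := by
  obtain ⟨C, hC, h⟩ := exists_harmonicMajorant_pow_le d
  have h1 : Tendsto (fun m : ℕ => C * (m : ℝ) ^ (-(1 / 2) : ℝ)) atTop (𝓝 0) := by
    simpa using ((tendsto_rpow_neg_atTop (y := 1 / 2) (by norm_num)).comp
      tendsto_natCast_atTop_atTop).const_mul C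
  refine squeeze_zero' ?_ ?_ h1
  · filter_upwards with m
    have := one_le_harmonicMajorant m
    positivity
  · filter_upwards [eventually_ge_atTop 1] with m hm
    have hm' : (0 : ℝ) < m := by exact_mod_cast hm
    calc _ ≤ C * (m : ℝ) ^ (1 / 2 : ℝ) / m := by gcongr; exact h m hm
      _ = C * ((m : ℝ) ^ (1 / 2 : ℝ) / (m : ℝ) ^ (1 : ℝ)) := by rw [Real.rpow_one]; ring
      _ = _ := by rw [← Real.rpow_sub hm']; norm_num

theorem summable_harmonicMajorant_pow_div_sq (d : ℕ) :
    Summable (fun m : ℕ => harmonicMajorant m ^ d / (m : ℝ) ^ 2) := by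
  obtain ⟨C, hC, h⟩ := exists_harmonicMajorant_pow_le d
  have h1 : Summable (fun m : ℕ => C * (m : ℝ) ^ (-(3 / 2) : ℝ)) :=
    (Real.summable_nat_rpow.mpr (by norm_num)).mul_left C
  refine Summable.of_nonneg_of_le (fun m => ?_) (fun m => ?_) h1
  · have := one_le_harmonicMajorant m
    positivity
  · rcases Nat.eq_zero_or_pos m with rfl | hm
    · simp [Real.zero_rpow (show (-(3 / 2) : ℝ) ≠ 0 by norm_num)]
    have hm' : (0 : ℝ) < m := by exact_mod_cast hm
    calc _ ≤ C * (m : ℝ) ^ (1 / 2 : ℝ) / (m : ℝ) ^ 2 := by gcongr; exact h m hm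
      _ = C * ((m : ℝ) ^ (1 / 2 : ℝ) / (m : ℝ) ^ (2 : ℝ)) := by rw [Real.rpow_two]; ring
      _ = _ := by rw [← Real.rpow_sub hm']; norm_num

theorem tendsto_mpvCoeff {l : List (ℕ × ℂ)} (h : AdmissibleWord l) :
    Tendsto (mpvCoeff l) atTop (𝓝 0) := by
  refine squeeze_zero_norm' ?_ (tendsto_harmonicMajorant_pow_div l.length)
  filter_upwards [eventually_ge_atTop 1] with n hn using norm_mpvCoeff_le h hn

theorem tendsto_partial_of_summable {l : List (ℕ × ℂ)} (h : AdmissibleWord l)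
    (hs : Summable (mpvCoeff l)) : ∃ v, Tendsto (mpvPartial l) atTop (𝓝 v) := by
  refine ⟨_, hs.hasSum.tendsto_sum_nat.congr' ?_⟩
  filter_upwards [eventually_ge_atTop 1] with m hm using (mpvPartial_eq_sum_mpvCoeff h hm).symm

theorem exists_tendsto_mpvPartial_of_two_le {s : ℕ} {z : ℂ} {t : List (ℕ × ℂ)} (hs : 2 ≤ s)
    (h : AdmissibleWord ((s, z) :: t)) :
    ∃ v, Tendsto (mpvPartial ((s, z) :: t)) atTop (𝓝 v) := by
  refine tendsto_partial_of_summable h (.of_norm_bounded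
    (summable_harmonicMajorant_pow_div_sq t.length) fun n => ?_)
  rcases Nat.eq_zero_or_pos n with rfl | hn
  · rw [mpvCoeff_zero_cons (by omega)]
    simp
  simp only [mpvCoeff]
  rw [norm_mul, mul_comm, div_eq_mul_one_div (harmonicMajorant n ^ _)]
  have := one_le_harmonicMajorant n
  exact mul_le_mul (norm_mpvPartial_le h.tail n) (norm_pow_div_natCast_pow_le h.head.2 hn hs)
    (norm_nonneg _) (by positivity)

theorem exists_tendsto_sum_pow_mul {z : ℂ} (hz : ‖z‖ ≤ 1) (hz1 : z ≠ 1) {a : ℕ → ℂ}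
    (ha0 : Tendsto a atTop (𝓝 0)) (ha : Summable fun n => ‖a (n + 1) - a n‖) :
    ∃ v, Tendsto (fun m => ∑ n ∈ Finset.range m, z ^ n * a n) atTop (𝓝 v) := by
  have hz2 : 1 - z ≠ 0 := sub_ne_zero.mpr hz1.symm
  have hid : ∀ m : ℕ, (1 - z) * ∑ n ∈ Finset.range (m + 1), z ^ n * a n
      = a 0 + ∑ n ∈ Finset.range m, z ^ (n + 1) * (a (n + 1) - a n) - z ^ (m + 1) * a m := by
    intro m
    induction m with
    | zero => simp; ring
    | succ m ih =>
      rw [Finset.sum_range_succ, mul_add, ih, Finset.sum_range_succ _ m]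
      ring
  have hsum : Summable fun n => z ^ (n + 1) * (a (n + 1) - a n) := by
    refine .of_norm_bounded ha fun n => ?_
    rw [norm_mul, norm_pow]
    exact mul_le_of_le_one_left (norm_nonneg _) (pow_le_one₀ (norm_nonneg _) hz)
  have hlast : Tendsto (fun m => z ^ (m + 1) * a m) atTop (𝓝 0) := by
    refine squeeze_zero_norm (fun m => ?_) (tendsto_zero_iff_norm_tendsto_zero.mp ha0)
    rw [norm_mul, norm_pow]
    exact mul_le_of_le_one_left (norm_nonneg _) (pow_le_one₀ (norm_nonneg _) hz)
  have h1 := ((hsum.hasSum.tendsto_sum_nat.const_add (a 0)).sub hlast).const_mul (1 - z)⁻¹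
  refine ⟨_, (tendsto_add_atTop_iff_nat 1).mp (h1.congr fun m => ?_)⟩
  rw [← hid, inv_mul_cancel_left₀ hz2]

theorem exists_tendsto_mpvPartial_of_ne_one {z : ℂ} {t : List (ℕ × ℂ)} (hz1 : z ≠ 1)
    (h : AdmissibleWord ((1, z) :: t)) :
    ∃ v, Tendsto (mpvPartial ((1, z) :: t)) atTop (𝓝 v) := by
  set d := t.length with hd
  have hb : ∀ n : ℕ, 1 ≤ n → ‖mpvPartial t (n + 1) / ((n + 1 : ℕ) : ℂ) - mpvPartial t n / (n : ℂ)‖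
      ≤ 2 * (harmonicMajorant n ^ d / (n : ℝ) ^ 2) := by
    intro n hn
    have hn' : (0 : ℝ) < n := by exact_mod_cast hn
    have hnc : (n : ℂ) ≠ 0 := by exact_mod_cast hn'.ne'
    have hnc1 : ((n + 1 : ℕ) : ℂ) ≠ 0 := by exact_mod_cast Nat.succ_ne_zero n
    have hK := one_le_harmonicMajorant n
    have h1 : mpvPartial t (n + 1) = mpvPartial t n + mpvCoeff t n := by
      rw [mpvPartial_eq_sum_mpvCoeff h.tail (by omega), Finset.sum_range_succ,
        ← mpvPartial_eq_sum_mpvCoeff h.tail hn]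
    have h2 : mpvPartial t (n + 1) / ((n + 1 : ℕ) : ℂ) - mpvPartial t n / (n : ℂ)
        = mpvCoeff t n / ((n + 1 : ℕ) : ℂ) - mpvPartial t n / ((n : ℂ) * ((n + 1 : ℕ) : ℂ)) := by
      rw [h1]
      field_simp
      push_cast
      ring
    have h3 : (n : ℝ) ≤ ((n + 1 : ℕ) : ℝ) := by exact_mod_cast Nat.le_succ n
    rw [h2]
    refine (norm_sub_le _ _).trans ?_
    rw [norm_div, norm_div, norm_mul, Complex.norm_natCast, Complex.norm_natCast, two_mul]
    refine add_le_add ?_ ?_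
    · calc _ ≤ (harmonicMajorant n ^ d / n) / n :=
            div_le_div₀ (by positivity) (norm_mpvCoeff_le h.tail hn) hn' h3
        _ = _ := by rw [div_div, sq]
    · refine div_le_div₀ (by positivity) (norm_mpvPartial_le h.tail n) (by positivity) ?_
      rw [sq]
      exact mul_le_mul_of_nonneg_left h3 hn'.le
  have ha0 : Tendsto (fun n : ℕ => mpvPartial t n / (n : ℂ)) atTop (𝓝 0) := by
    refine squeeze_zero_norm (fun n => ?_) (tendsto_harmonicMajorant_pow_div d)
    rw [norm_div, Complex.norm_natCast]
    gcongr
    exact norm_mpvPartial_le h.tail n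
  have hsum : Summable fun n : ℕ =>
      ‖mpvPartial t (n + 1) / ((n + 1 : ℕ) : ℂ) - mpvPartial t n / (n : ℂ)‖ := by
    refine Summable.of_norm_bounded_eventually_nat
      ((summable_harmonicMajorant_pow_div_sq d).mul_left 2) ?_
    filter_upwards [eventually_ge_atTop 1] with n hn
    rw [norm_norm]
    exact hb n hn
  obtain ⟨v, hv⟩ := exists_tendsto_sum_pow_mul h.head.2 hz1 ha0 hsum
  refine ⟨v, hv.congr' ?_⟩
  filter_upwards [eventually_ge_atTop 1] with m hm
  rw [mpvPartial_eq_sum_mpvCoeff h hm]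
  refine Finset.sum_congr rfl fun n _ => ?_
  simp only [mpvCoeff]
  ring

theorem tendsto_mpvPartial_Li {s : ℕ} {z : ℂ} {t : List (ℕ × ℂ)} (hsz : 2 ≤ s ∨ z ≠ 1)
    (h : AdmissibleWord ((s, z) :: t)) :
    Tendsto (mpvPartial ((s, z) :: t)) atTop (𝓝 (Li ((s, z) :: t))) := by
  refine tendsto_nhds_limUnder ?_
  rcases Nat.lt_or_ge s 2 with hs | hs
  · obtain rfl : s = 1 := by have := h.head.1; simp only at this; omega
    exact exists_tendsto_mpvPartial_of_ne_one (hsz.resolve_left (by omega)) h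
  · exact exists_tendsto_mpvPartial_of_two_le hs h

/-- The one-variable generating function of a multiple polylogarithm. -/
noncomputable def mpvGen (l : List (ℕ × ℂ)) (x : ℂ) : ℂ :=
  ∑' n, mpvCoeff l n * x ^ n

theorem exists_norm_mpvCoeff_le {l : List (ℕ × ℂ)} (h : AdmissibleWord l) :
    ∃ B : ℝ, ∀ n, ‖mpvCoeff l n‖ ≤ B := by
  obtain ⟨B, hB⟩ := (tendsto_mpvCoeff h).norm.bddAbove_range
  exact ⟨B, fun n => hB ⟨n, rfl⟩⟩

theorem hasSum_mul_pow_of_norm_le {c : ℕ → ℂ} {B : ℝ} (hB : ∀ n, ‖c n‖ ≤ B) {x : ℂ}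
    (hx : ‖x‖ < 1) : HasSum (fun n => c n * x ^ n) (∑' n, c n * x ^ n) := by
  refine (Summable.of_norm_bounded ((summable_geometric_of_lt_one (norm_nonneg x) hx).mul_left B)
    fun n => ?_).hasSum
  rw [norm_mul, norm_pow]
  gcongr
  exact hB n

theorem hasDerivAt_tsum_mul_pow {c : ℕ → ℂ} {B : ℝ} (hB : ∀ n, ‖c n‖ ≤ B) {x : ℂ}
    (hx : ‖x‖ < 1) : ∃ D, HasDerivAt (fun w => ∑' n, c n * w ^ n) D x ∧
      HasSum (fun n => c n * (n * x ^ (n - 1))) D := by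
  obtain ⟨r, hxr, hr⟩ := exists_between hx
  have hr0 : 0 ≤ r := (norm_nonneg x).trans hxr.le
  have hu : Summable fun n => B * r ^ n := (summable_geometric_of_lt_one hr0 hr).mul_left B
  have hd : ∀ n : ℕ, DifferentiableOn ℂ (fun w => c n * w ^ n) (Metric.ball 0 r) := fun n => by
    fun_prop
  have hle : ∀ (n : ℕ), ∀ w ∈ Metric.ball (0 : ℂ) r, ‖c n * w ^ n‖ ≤ B * r ^ n := by
    intro n w hw
    rw [mem_ball_zero_iff] at hw
    rw [norm_mul, norm_pow]
    have := (norm_nonneg _).trans (hB n)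
    gcongr
    exact hB n
  have hmem : x ∈ Metric.ball (0 : ℂ) r := mem_ball_zero_iff.mpr hxr
  refine ⟨_, ((Complex.differentiableOn_tsum_of_summable_norm hu hd Metric.isOpen_ball hle
    ).differentiableAt (Metric.isOpen_ball.mem_nhds hmem)).hasDerivAt, ?_⟩
  refine (Complex.hasSum_deriv_of_summable_norm hu hd Metric.isOpen_ball hle hmem).congr_fun
    fun n => ?_
  rw [deriv_const_mul _ (by fun_prop)]
  simp

theorem norm_mul_lt_one {z x : ℂ} (hz : ‖z‖ ≤ 1) (hx : ‖x‖ < 1) : ‖z * x‖ < 1 := by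
  rw [norm_mul]
  exact (mul_le_of_le_one_left (norm_nonneg _) hz).trans_lt hx

theorem one_sub_mul_ne_zero {z x : ℂ} (hz : ‖z‖ ≤ 1) (hx : ‖x‖ < 1) : 1 - z * x ≠ 0 := by
  intro h
  have := norm_mul_lt_one hz hx
  rw [← sub_eq_zero.mp h, norm_one] at this
  exact lt_irrefl _ this

theorem mpvPartial_succ {l : List (ℕ × ℂ)} (h : AdmissibleWord l) {m : ℕ} (hm : 1 ≤ m) :
    mpvPartial l (m + 1) = mpvPartial l m + mpvCoeff l m := by
  rw [mpvPartial_eq_sum_mpvCoeff h (by omega), Finset.sum_range_succ,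
    ← mpvPartial_eq_sum_mpvCoeff h hm]

theorem hasDerivAt_mpvGen_one_cons {z : ℂ} {t : List (ℕ × ℂ)}
    (h : AdmissibleWord ((1, z) :: t)) {x : ℂ} (hx : ‖x‖ < 1) :
    HasDerivAt (mpvGen ((1, z) :: t)) (z / (1 - z * x) * mpvGen t (z * x)) x := by
  obtain ⟨B, hB⟩ := exists_norm_mpvCoeff_le h
  obtain ⟨D, hD, hS⟩ := hasDerivAt_tsum_mul_pow hB hx
  obtain ⟨B', hB'⟩ := exists_norm_mpvCoeff_le h.tail
  have hz := h.head.2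
  have hE := (hasSum_nat_add_iff' 1).mpr (hasSum_mul_pow_of_norm_le hB' (norm_mul_lt_one hz hx))
  have h1 : HasSum (fun n : ℕ => z ^ (n + 1) * mpvPartial t (n + 1) * x ^ n) D := by
    have := (hasSum_nat_add_iff' 1).mpr hS
    simp only [Finset.sum_range_one, Nat.cast_zero, zero_mul, mul_zero, sub_zero] at this
    refine this.congr_fun fun n => ?_
    have hn : ((n + 1 : ℕ) : ℂ) ≠ 0 := by exact_mod_cast Nat.succ_ne_zero n
    simp only [mpvCoeff, Nat.add_sub_cancel, pow_one]
    field_simp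
  have h2 := (hasSum_nat_add_iff' 1).mpr h1
  have h3 := (h2.sub (h1.mul_left (z * x)))
  have h4 := h3.unique ((hE.mul_left z).congr_fun fun n => ?_)
  · have hp : mpvPartial t 1 = mpvCoeff t 0 := by
      rw [mpvPartial_eq_sum_mpvCoeff h.tail le_rfl, Finset.sum_range_one]
    simp only [Finset.sum_range_one, pow_zero, mul_one, zero_add, pow_one, hp] at h4
    have h5 : D = z / (1 - z * x) * mpvGen t (z * x) := by
      rw [div_mul_eq_mul_div, eq_div_iff (one_sub_mul_ne_zero hz hx), mpvGen]
      linear_combination h4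
    rw [← h5]
    exact hD
  · simp only [mpvPartial_succ h.tail (Nat.succ_le_succ (Nat.zero_le n))]
    ring

theorem hasDerivAt_mpvGen_two_cons {z : ℂ} {t : List (ℕ × ℂ)}
    (h : AdmissibleWord ((2, z) :: t)) {x : ℂ} (hx : ‖x‖ < 1) (hx0 : x ≠ 0) :
    HasDerivAt (mpvGen ((2, z) :: t)) (mpvGen ((1, z) :: t) x / x) x := by
  obtain ⟨B, hB⟩ := exists_norm_mpvCoeff_le h
  obtain ⟨D, hD, hS⟩ := hasDerivAt_tsum_mul_pow hB hx
  have h1 : mpvGen ((1, z) :: t) x / x = D := by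
    rw [div_eq_iff hx0, mpvGen, ← (hS.mul_right x).tsum_eq]
    refine tsum_congr fun n => ?_
    rcases Nat.eq_zero_or_pos n with rfl | hn
    · simp [mpvCoeff]
    · have hn' : (n : ℂ) ≠ 0 := by exact_mod_cast hn.ne'
      obtain ⟨k, rfl⟩ := Nat.exists_eq_succ_of_ne_zero hn.ne'
      simp only [mpvCoeff, Nat.succ_eq_add_one, Nat.add_sub_cancel, pow_succ x] at hn' ⊢
      field_simp
  rw [h1]
  exact hD

theorem mpvGen_singleton {z x : ℂ} (hz : ‖z‖ ≤ 1) (hx : ‖x‖ < 1) :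
    mpvGen [(1, z)] x = -Complex.log (1 - z * x) := by
  rw [← (Complex.hasSum_taylorSeries_neg_log (norm_mul_lt_one hz hx)).tsum_eq, mpvGen]
  refine tsum_congr fun n => ?_
  simp only [mpvCoeff, mpvPartial, mul_pow]
  ring

theorem mpvGen_cons_zero {s : ℕ} (hs : 0 < s) (z : ℂ) (t : List (ℕ × ℂ)) :
    mpvGen ((s, z) :: t) 0 = 0 := by
  rw [mpvGen, tsum_eq_single 0]
  · simp [mpvCoeff_zero_cons hs]
  · intro n hn
    simp [hn]

theorem tendsto_mpvGen_Li {s : ℕ} {z : ℂ} {t : List (ℕ × ℂ)} (hsz : 2 ≤ s ∨ z ≠ 1)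
    (h : AdmissibleWord ((s, z) :: t)) :
    Tendsto (fun x : ℝ => mpvGen ((s, z) :: t) x) (𝓝[<] 1) (𝓝 (Li ((s, z) :: t))) := by
  refine Complex.tendsto_tsum_powerSeries_nhdsWithin_lt ((tendsto_mpvPartial_Li hsz h).congr' ?_)
  filter_upwards [eventually_ge_atTop 1] with m hm using mpvPartial_eq_sum_mpvCoeff h hm

theorem tendsto_one_sub_mul_mpvGen {s : ℕ} {z : ℂ} {t : List (ℕ × ℂ)}
    (h : AdmissibleWord ((s, z) :: t)) {u : ℂ} (hu : ‖u‖ ≤ 1) :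
    Tendsto (fun x : ℝ => (1 - (x : ℂ)) * mpvGen ((s, z) :: t) (u * x)) (𝓝[<] 1) (𝓝 0) := by
  set c : ℕ → ℂ := fun n => mpvCoeff ((s, z) :: t) n * u ^ n with hc
  have hle : ∀ n, ‖c n‖ ≤ ‖mpvCoeff ((s, z) :: t) n‖ := fun n => by
    rw [norm_mul, norm_pow]
    exact mul_le_of_le_one_right (norm_nonneg _) (pow_le_one₀ (norm_nonneg _) hu)
  obtain ⟨B, hB⟩ := exists_norm_mpvCoeff_le h
  have hcB : ∀ n, ‖c n‖ ≤ B := fun n => (hle n).trans (hB n)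
  have hc0 : c 0 = 0 := by simp [hc, mpvCoeff_zero_cons h.head.1]
  have hct : Tendsto c atTop (𝓝 0) :=
    squeeze_zero_norm hle (tendsto_zero_iff_norm_tendsto_zero.mp (tendsto_mpvCoeff h))
  have hd : Tendsto (fun m => ∑ n ∈ Finset.range m, (c (n + 1) - c n)) atTop (𝓝 0) := by
    simpa only [Finset.sum_range_sub, hc0, sub_zero] using hct
  have h1 := Complex.tendsto_tsum_powerSeries_nhdsWithin_lt hd
  rw [tendsto_map'_iff] at h1
  have h2 : Tendsto (fun x : ℝ => (x : ℂ)) (𝓝[<] 1) (𝓝 (1 : ℝ)) :=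
    (Complex.continuous_ofReal.tendsto 1).mono_left nhdsWithin_le_nhds
  have h3 := h2.mul h1
  rw [mul_zero] at h3
  refine h3.congr' ?_
  filter_upwards [Ioo_mem_nhdsLT (show (0 : ℝ) < 1 by norm_num)] with x hx
  have hx' : ‖(x : ℂ)‖ < 1 := by
    rw [Complex.norm_real, Real.norm_of_nonneg hx.1.le]
    exact hx.2
  have hs := hasSum_mul_pow_of_norm_le hcB hx'
  have hg : mpvGen ((s, z) :: t) (u * x) = ∑' n, c n * (x : ℂ) ^ n := by
    rw [mpvGen]
    exact tsum_congr fun n => by simp only [hc, mul_pow, mul_assoc]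
  have h4 := ((hasSum_nat_add_iff' 1).mpr hs).sub (hs.mul_left (x : ℂ))
  simp only [Finset.sum_range_one, hc0, zero_mul, sub_zero] at h4
  simp only [Function.comp_apply]
  rw [hg, ← tsum_mul_left, sub_mul, one_mul, ← h4.tsum_eq]
  exact tsum_congr fun n => by ring

section

open MeasureTheory Set

/-- `f` is integrable over the open unit interval, with integral `v`. -/
def HasUnitIntegral (f : ℝ → ℂ) (v : ℂ) : Prop :=
  IntegrableOn f (Ioo 0 1) ∧ ∫ t in Ioo (0 : ℝ) 1, f t = v

theorem HasUnitIntegral.add {f g : ℝ → ℂ} {u v : ℂ} (hf : HasUnitIntegral f u)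
    (hg : HasUnitIntegral g v) : HasUnitIntegral (fun t => f t + g t) (u + v) :=
  ⟨hf.1.add hg.1, by rw [integral_add hf.1 hg.1, hf.2, hg.2]⟩

theorem HasUnitIntegral.sub {f g : ℝ → ℂ} {u v : ℂ} (hf : HasUnitIntegral f u)
    (hg : HasUnitIntegral g v) : HasUnitIntegral (fun t => f t - g t) (u - v) :=
  ⟨hf.1.sub hg.1, by rw [integral_sub hf.1 hg.1, hf.2, hg.2]⟩

theorem HasUnitIntegral.const_mul {f : ℝ → ℂ} {v : ℂ} (hf : HasUnitIntegral f v) (c : ℂ) :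
    HasUnitIntegral (fun t => c * f t) (c * v) :=
  ⟨Integrable.const_mul hf.1 c, by rw [integral_const_mul, hf.2]⟩

theorem HasUnitIntegral.congr {f g : ℝ → ℂ} {v : ℂ} (hf : HasUnitIntegral f v)
    (h : ∀ t ∈ Ioo (0 : ℝ) 1, f t = g t) : HasUnitIntegral g v :=
  ⟨hf.1.congr_fun h measurableSet_Ioo, by rw [← setIntegral_congr_fun measurableSet_Ioo h, hf.2]⟩

theorem HasUnitIntegral.unique {f : ℝ → ℂ} {u v : ℂ} (hf : HasUnitIntegral f u)
    (hg : HasUnitIntegral f v) : u = v :=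
  hf.2.symm.trans hg.2

theorem hasUnitIntegral_of_hasDerivAt {F f : ℝ → ℂ} {A B : ℂ} (hf : IntegrableOn f (Ioo 0 1))
    (hd : ∀ t ∈ Ioo (0 : ℝ) 1, HasDerivAt F (f t) t) (h0 : Tendsto F (𝓝[>] 0) (𝓝 A))
    (h1 : Tendsto F (𝓝[<] 1) (𝓝 B)) : HasUnitIntegral f (B - A) := by
  refine ⟨hf, ?_⟩
  rw [← integral_Ioc_eq_integral_Ioo, ← intervalIntegral.integral_of_le zero_le_one]
  exact intervalIntegral.integral_eq_sub_of_hasDerivAt_of_tendsto zero_lt_one hd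
    ((intervalIntegrable_iff_integrableOn_Ioo_of_le zero_le_one).mpr hf) h0 h1

theorem hasUnitIntegral_comp {σ σ' : ℝ → ℝ} (himg : σ '' Ioo 0 1 = Ioo 0 1)
    (hinj : InjOn σ (Ioo 0 1)) (hd : ∀ t ∈ Ioo (0 : ℝ) 1, HasDerivAt σ (σ' t) t)
    {f : ℝ → ℂ} {v : ℂ} (hf : HasUnitIntegral f v) :
    HasUnitIntegral (fun t => |σ' t| • f (σ t)) v := by
  have hd' : ∀ t ∈ Ioo (0 : ℝ) 1, HasDerivWithinAt σ (σ' t) (Ioo 0 1) t := fun t ht =>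
    (hd t ht).hasDerivWithinAt
  constructor
  · rw [← integrableOn_image_iff_integrableOn_abs_deriv_smul measurableSet_Ioo hd' hinj, himg]
    exact hf.1
  · rw [← integral_image_eq_integral_abs_deriv_smul measurableSet_Ioo hd' hinj, himg]
    exact hf.2

theorem HasUnitIntegral.comp_sq {f : ℝ → ℂ} {v : ℂ} (hf : HasUnitIntegral f v) :
    HasUnitIntegral (fun t => 2 * (t : ℂ) * f (t ^ 2)) v := by
  have himg : (fun t : ℝ => t ^ 2) '' Ioo 0 1 = Ioo 0 1 := by
    ext y
    constructor
    · rintro ⟨t, ⟨h0, h1⟩, rfl⟩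
      exact ⟨by positivity, by nlinarith⟩
    · rintro ⟨h0, h1⟩
      exact ⟨√y, ⟨Real.sqrt_pos.mpr h0, by rw [Real.sqrt_lt' one_pos]; linarith⟩,
        Real.sq_sqrt h0.le⟩
  refine (hasUnitIntegral_comp (σ' := fun t => 2 * t) himg ?_ (fun t _ => ?_) hf).congr
    fun t ht => ?_
  · intro a ha b hb h
    exact (pow_left_inj₀ ha.1.le hb.1.le two_ne_zero).mp h
  · simpa using hasDerivAt_pow 2 t
  · rw [abs_of_pos (mul_pos two_pos ht.1), Complex.real_smul]
    push_cast
    rfl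

theorem one_sub_div_one_add_mem {t : ℝ} (ht : t ∈ Ioo (0 : ℝ) 1) :
    (1 - t) / (1 + t) ∈ Ioo (0 : ℝ) 1 := by
  obtain ⟨h0, h1⟩ := ht
  constructor
  · apply div_pos <;> linarith
  · rw [div_lt_one (by linarith)]
    linarith

theorem one_sub_div_one_add_involutive {t : ℝ} (ht : t ∈ Ioo (0 : ℝ) 1) :
    (1 - (1 - t) / (1 + t)) / (1 + (1 - t) / (1 + t)) = t := by
  have : 1 + t ≠ 0 := by linarith [ht.1]
  field_simp
  ring

theorem HasUnitIntegral.comp_one_sub_div_one_add {f : ℝ → ℂ} {v : ℂ}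
    (hf : HasUnitIntegral f v) :
    HasUnitIntegral (fun t => 2 / (1 + (t : ℂ)) ^ 2 * f ((1 - t) / (1 + t))) v := by
  have himg : (fun t : ℝ => (1 - t) / (1 + t)) '' Ioo 0 1 = Ioo 0 1 := by
    ext y
    constructor
    · rintro ⟨t, ht, rfl⟩
      exact one_sub_div_one_add_mem ht
    · intro hy
      exact ⟨_, one_sub_div_one_add_mem hy, one_sub_div_one_add_involutive hy⟩
  refine (hasUnitIntegral_comp (σ' := fun t => -(2 / (1 + t) ^ 2)) himg ?_ (fun t ht => ?_)
    hf).congr fun t ht => ?_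
  · intro a ha b hb h
    have h' : (1 - a) / (1 + a) = (1 - b) / (1 + b) := h
    rw [← one_sub_div_one_add_involutive ha, ← one_sub_div_one_add_involutive hb, h']
  · have h1 : 1 + t ≠ 0 := by linarith [ht.1]
    have := ((hasDerivAt_id t).const_sub 1).div ((hasDerivAt_id t).const_add 1) h1
    refine this.congr_deriv ?_
    simp only [id_eq]
    field_simp
    ring
  · rw [abs_neg, abs_of_pos (by have := ht.1; positivity), Complex.real_smul]
    push_cast
    rfl

/-- Continuous functions on the open unit interval with at most fourth-root singularities at
the endpoints. -/
def MildSingular (f : ℝ → ℂ) : Prop :=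
  ContinuousOn f (Ioo 0 1) ∧
    ∃ C : ℝ, ∀ t ∈ Ioo (0 : ℝ) 1, ‖f t‖ ≤ C * (t * (1 - t)) ^ (-(1 / 4) : ℝ)

theorem mul_one_sub_mem {t : ℝ} (ht : t ∈ Ioo (0 : ℝ) 1) :
    0 < t * (1 - t) ∧ t * (1 - t) ≤ 1 := by
  obtain ⟨h0, h1⟩ := ht
  constructor
  · exact mul_pos h0 (by linarith)
  · nlinarith

theorem one_le_rpow_mul_one_sub {t : ℝ} (ht : t ∈ Ioo (0 : ℝ) 1) :
    1 ≤ (t * (1 - t)) ^ (-(1 / 4) : ℝ) := by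
  obtain ⟨h0, h1⟩ := mul_one_sub_mem ht
  exact Real.one_le_rpow_of_pos_of_le_one_of_nonpos h0 h1 (by norm_num)

theorem MildSingular.add {f g : ℝ → ℂ} (hf : MildSingular f) (hg : MildSingular g) :
    MildSingular (fun t => f t + g t) := by
  obtain ⟨C, hC⟩ := hf.2
  obtain ⟨D, hD⟩ := hg.2
  refine ⟨hf.1.add hg.1, C + D, fun t ht => (norm_add_le _ _).trans ?_⟩
  rw [add_mul]
  exact add_le_add (hC t ht) (hD t ht)

theorem mildSingular_of_bounded {f : ℝ → ℂ} {C : ℝ} (hf : ContinuousOn f (Ioo 0 1))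
    (hC : ∀ t ∈ Ioo (0 : ℝ) 1, ‖f t‖ ≤ C) : MildSingular f := by
  refine ⟨hf, C, fun t ht => (hC t ht).trans ?_⟩
  exact le_mul_of_one_le_right ((norm_nonneg _).trans (hC t ht)) (one_le_rpow_mul_one_sub ht)

theorem mildSingular_const (c : ℂ) : MildSingular (fun _ => c) :=
  mildSingular_of_bounded continuousOn_const fun _ _ => le_rfl

theorem MildSingular.mul_bounded {f g : ℝ → ℂ} {B : ℝ} (hf : MildSingular f)
    (hg : ContinuousOn g (Ioo 0 1)) (hB : ∀ t ∈ Ioo (0 : ℝ) 1, ‖g t‖ ≤ B) :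
    MildSingular (fun t => f t * g t) := by
  obtain ⟨C, hC⟩ := hf.2
  refine ⟨hf.1.mul hg, C * B, fun t ht => ?_⟩
  rw [norm_mul, mul_right_comm]
  exact mul_le_mul (hC t ht) (hB t ht) (norm_nonneg _) ((norm_nonneg _).trans (hC t ht))

theorem MildSingular.const_mul {f : ℝ → ℂ} (hf : MildSingular f) (c : ℂ) :
    MildSingular (fun t => c * f t) := by
  simpa only [mul_comm] using
    hf.mul_bounded (g := fun _ => c) continuousOn_const fun _ _ => le_rfl

theorem MildSingular.sub {f g : ℝ → ℂ} (hf : MildSingular f) (hg : MildSingular g) :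
    MildSingular (fun t => f t - g t) := by
  simpa [sub_eq_add_neg] using hf.add (hg.const_mul (-1))

theorem MildSingular.congr {f g : ℝ → ℂ} (hf : MildSingular f)
    (h : ∀ t ∈ Ioo (0 : ℝ) 1, f t = g t) : MildSingular g := by
  obtain ⟨C, hC⟩ := hf.2
  exact ⟨hf.1.congr fun t ht => (h t ht).symm, C, fun t ht => h t ht ▸ hC t ht⟩

theorem integrableOn_rpow_mul_one_sub :
    IntegrableOn (fun t : ℝ => (t * (1 - t)) ^ (-(1 / 2) : ℝ)) (Ioo 0 1) := by
  have h := Complex.betaIntegral_convergent (u := 1 / 2) (v := 1 / 2) (by norm_num) (by norm_num)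
  rw [intervalIntegrable_iff_integrableOn_Ioo_of_le zero_le_one] at h
  refine IntegrableOn.congr_fun h.norm (fun t ht => ?_) measurableSet_Ioo
  have h1 : 0 < 1 - t := by linarith [ht.2]
  have h2 : (1 : ℂ) - (t : ℂ) = ((1 - t : ℝ) : ℂ) := by push_cast; rfl
  rw [norm_mul, h2, Complex.norm_cpow_eq_rpow_re_of_pos ht.1,
    Complex.norm_cpow_eq_rpow_re_of_pos h1, Real.mul_rpow ht.1.le h1.le]
  norm_num

theorem MildSingular.integrableOn_mul {f g : ℝ → ℂ} (hf : MildSingular f)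
    (hg : MildSingular g) : IntegrableOn (fun t => f t * g t) (Ioo 0 1) := by
  obtain ⟨C, hC⟩ := hf.2
  obtain ⟨D, hD⟩ := hg.2
  refine Integrable.mono' (integrableOn_rpow_mul_one_sub.const_mul (C * D))
    ((hf.1.mul hg.1).aestronglyMeasurable measurableSet_Ioo) ?_
  refine (ae_restrict_iff' measurableSet_Ioo).mpr (Eventually.of_forall fun t ht => ?_)
  have h0 := (mul_one_sub_mem ht).1
  rw [norm_mul]
  calc _ ≤ (C * (t * (1 - t)) ^ (-(1 / 4) : ℝ)) * (D * (t * (1 - t)) ^ (-(1 / 4) : ℝ)) :=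
        mul_le_mul (hC t ht) (hD t ht) (norm_nonneg _) ((norm_nonneg _).trans (hC t ht))
    _ = C * D * ((t * (1 - t)) ^ (-(1 / 4) : ℝ) * (t * (1 - t)) ^ (-(1 / 4) : ℝ)) := by ring
    _ = _ := by rw [← Real.rpow_add h0]; norm_num

theorem MildSingular.tendsto_mul_mul_mul {f g h : ℝ → ℂ} (hf : MildSingular f)
    (hg : MildSingular g) (hh : MildSingular h) {l : Filter ℝ} {p : ℝ} (hl : l ≤ 𝓝 p)
    (hl' : Ioo 0 1 ∈ l) (hp : p * (1 - p) = 0) :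
    Tendsto (fun t : ℝ => (t : ℂ) * (1 - t) * (f t * g t * h t)) l (𝓝 0) := by
  obtain ⟨C, hC⟩ := hf.2
  obtain ⟨D, hD⟩ := hg.2
  obtain ⟨E, hE⟩ := hh.2
  have h1 : Tendsto (fun t : ℝ => C * D * E * (t * (1 - t)) ^ (1 / 4 : ℝ)) l (𝓝 0) := by
    have : Continuous fun t : ℝ => C * D * E * (t * (1 - t)) ^ (1 / 4 : ℝ) := by
      refine continuous_const.mul (Continuous.rpow_const (by fun_prop) fun t => ?_)
      right
      norm_num
    have h2 := (this.tendsto p).mono_left hl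
    rwa [hp, Real.zero_rpow (by norm_num), mul_zero] at h2
  refine squeeze_zero_norm' ?_ h1
  filter_upwards [hl'] with t ht
  have h0 := (mul_one_sub_mem ht).1
  have h2 : (t : ℂ) * (1 - t) = ((t * (1 - t) : ℝ) : ℂ) := by push_cast; rfl
  rw [h2, norm_mul, norm_mul, norm_mul, Complex.norm_real, Real.norm_of_nonneg h0.le]
  set w := (t * (1 - t)) ^ (-(1 / 4) : ℝ) with hw
  have hw0 : 0 ≤ w := Real.rpow_nonneg h0.le _
  have hC0 := (norm_nonneg _).trans (hC t ht)
  have hD0 := (norm_nonneg _).trans (hD t ht)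
  calc _ ≤ t * (1 - t) * (C * w * (D * w) * (E * w)) := by
        refine mul_le_mul_of_nonneg_left ?_ h0.le
        exact mul_le_mul (mul_le_mul (hC t ht) (hD t ht) (norm_nonneg _) hC0) (hE t ht)
          (norm_nonneg _) (mul_nonneg hC0 hD0)
    _ = C * D * E * (t * (1 - t) * (w * w * w)) := by ring
    _ = _ := by
      rw [hw, ← Real.rpow_add h0, ← Real.rpow_add h0]
      nth_rewrite 1 [← Real.rpow_one (t * (1 - t))]
      rw [← Real.rpow_add h0]
      norm_num

/-- The logarithm of `1 - y t` as a function of a real variable. -/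
noncomputable def logOneSub (y : ℂ) (t : ℝ) : ℂ := Complex.log (1 - y * t)

/-- The derivative of `logOneSub y`. -/
noncomputable def dlogOneSub (y : ℂ) (t : ℝ) : ℂ := -y / (1 - y * t)

/-- The real logarithm with complex values. -/
noncomputable def logReal (t : ℝ) : ℂ := (Real.log t : ℂ)

theorem one_sub_mul_re (y : ℂ) (t : ℝ) : (1 - y * t).re = 1 - y.re * t := by
  simp

theorem one_sub_mul_mem_slitPlane {y : ℂ} (hy : ‖y‖ ≤ 1) {t : ℝ} (ht : t ∈ Ioo (0 : ℝ) 1) :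
    1 - y * t ∈ Complex.slitPlane := by
  left
  rw [one_sub_mul_re]
  have := (Complex.re_le_norm y).trans hy
  nlinarith [ht.1, ht.2]

theorem hasDerivAt_logOneSub_of_mem {y : ℂ} {t : ℝ} (h : 1 - y * t ∈ Complex.slitPlane) :
    HasDerivAt (logOneSub y) (dlogOneSub y t) t := by
  have h1 : HasDerivAt (fun s : ℝ => 1 - y * (s : ℂ)) (-y) t := by
    simpa using (((hasDerivAt_id (t : ℂ)).comp_ofReal.const_mul y).const_sub 1)
  exact h1.clog_real h

theorem hasDerivAt_logOneSub {y : ℂ} (hy : ‖y‖ ≤ 1) {t : ℝ} (ht : t ∈ Ioo (0 : ℝ) 1) :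
    HasDerivAt (logOneSub y) (dlogOneSub y t) t :=
  hasDerivAt_logOneSub_of_mem (one_sub_mul_mem_slitPlane hy ht)

theorem hasDerivAt_logReal {t : ℝ} (ht : t ∈ Ioo (0 : ℝ) 1) :
    HasDerivAt logReal (1 / (t : ℂ)) t := by
  have := (Real.hasDerivAt_log ht.1.ne').ofReal_comp
  exact this.congr_deriv (by simp)

theorem continuousOn_logOneSub {y : ℂ} (hy : ‖y‖ ≤ 1) : ContinuousOn (logOneSub y) (Ioo 0 1) :=
  fun _ ht => (hasDerivAt_logOneSub hy ht).continuousAt.continuousWithinAt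

theorem continuousOn_logReal : ContinuousOn logReal (Ioo 0 1) :=
  fun _ ht => (hasDerivAt_logReal ht).continuousAt.continuousWithinAt

theorem continuousOn_dlogOneSub {y : ℂ} (hy : ‖y‖ ≤ 1) :
    ContinuousOn (dlogOneSub y) (Ioo 0 1) := by
  refine ContinuousOn.div continuousOn_const (by fun_prop) fun t ht => ?_
  exact Complex.slitPlane_ne_zero (one_sub_mul_mem_slitPlane hy ht)

theorem abs_log_le_rpow {x : ℝ} (h0 : 0 < x) (h1 : x ≤ 1) :
    |Real.log x| ≤ 4 * x ^ (-(1 / 4) : ℝ) := by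
  have h := Real.abs_log_mul_self_rpow_lt x (1 / 4) h0 h1 (by norm_num)
  rw [abs_mul, abs_of_pos (Real.rpow_pos_of_pos h0 _)] at h
  have h2 : x ^ (1 / 4 : ℝ) * x ^ (-(1 / 4) : ℝ) = 1 := by
    rw [← Real.rpow_add h0]
    norm_num
  have h3 : 0 ≤ x ^ (-(1 / 4) : ℝ) := Real.rpow_nonneg h0.le _
  calc _ = |Real.log x| * x ^ (1 / 4 : ℝ) * x ^ (-(1 / 4) : ℝ) := by rw [mul_assoc, h2, mul_one]
    _ ≤ _ := mul_le_mul_of_nonneg_right (by linarith) h3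

theorem mildSingular_logReal : MildSingular logReal := by
  refine ⟨continuousOn_logReal, 4, fun t ht => ?_⟩
  have h1 : 0 < 1 - t := by linarith [ht.2]
  rw [logReal, Complex.norm_real, Real.norm_eq_abs]
  refine (abs_log_le_rpow ht.1 ht.2.le).trans (mul_le_mul_of_nonneg_left ?_ (by norm_num))
  exact Real.rpow_le_rpow_of_nonpos (mul_one_sub_mem ht).1 (by nlinarith [ht.1]) (by norm_num)

theorem one_sub_le_norm_one_sub_mul {y : ℂ} (hy : ‖y‖ ≤ 1) {t : ℝ} (ht : t ∈ Ioo (0 : ℝ) 1) :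
    1 - t ≤ ‖1 - y * t‖ := by
  have h1 := norm_sub_norm_le (1 : ℂ) (y * t)
  have h2 : ‖y * (t : ℂ)‖ ≤ t := by
    rw [norm_mul, Complex.norm_real, Real.norm_of_nonneg ht.1.le]
    exact mul_le_of_le_one_left ht.1.le hy
  rw [norm_one] at h1
  linarith

theorem norm_logOneSub_le {y : ℂ} (hy : ‖y‖ ≤ 1) {t : ℝ} (ht : t ∈ Ioo (0 : ℝ) 1) :
    ‖logOneSub y t‖ ≤ 5 + 4 * (1 - t) ^ (-(1 / 4) : ℝ) := by
  have h1 : 0 < 1 - t := by linarith [ht.2]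
  have hlow := one_sub_le_norm_one_sub_mul hy ht
  have hup : ‖1 - y * (t : ℂ)‖ ≤ 2 := by
    refine (norm_sub_le _ _).trans ?_
    rw [norm_one, norm_mul, Complex.norm_real, Real.norm_of_nonneg ht.1.le]
    have := mul_le_mul hy ht.2.le ht.1.le zero_le_one
    linarith
  have hre : |(logOneSub y t).re| ≤ 1 + 4 * (1 - t) ^ (-(1 / 4) : ℝ) := by
    rw [logOneSub, Complex.log_re, abs_le]
    have h2 := abs_log_le_rpow h1 (by linarith [ht.1])
    have h3 := neg_abs_le (Real.log (1 - t))
    have h4 := Real.log_le_log h1 hlow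
    have h5 := Real.log_le_log (h1.trans_le hlow) hup
    have h6 := Real.log_two_lt_d9
    have h7 : 0 ≤ (1 - t) ^ (-(1 / 4) : ℝ) := Real.rpow_nonneg h1.le _
    constructor <;> linarith
  have him : |(logOneSub y t).im| ≤ 4 := by
    rw [logOneSub, Complex.log_im]
    exact (Complex.abs_arg_le_pi _).trans Real.pi_le_four
  linarith [Complex.norm_le_abs_re_add_abs_im (logOneSub y t)]

theorem mildSingular_logOneSub {y : ℂ} (hy : ‖y‖ ≤ 1) : MildSingular (logOneSub y) := by
  refine ⟨continuousOn_logOneSub hy, 9, fun t ht => (norm_logOneSub_le hy ht).trans ?_⟩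
  have h1 : 0 < 1 - t := by linarith [ht.2]
  have h2 : (1 - t) ^ (-(1 / 4) : ℝ) ≤ (t * (1 - t)) ^ (-(1 / 4) : ℝ) :=
    Real.rpow_le_rpow_of_nonpos (mul_one_sub_mem ht).1 (by nlinarith [ht.2]) (by norm_num)
  linarith [one_le_rpow_mul_one_sub ht]

theorem MildSingular.of_norm_le {f g : ℝ → ℂ} (hg : MildSingular g)
    (hf : ContinuousOn f (Ioo 0 1)) {B : ℝ} (hB : 0 ≤ B)
    (h : ∀ t ∈ Ioo (0 : ℝ) 1, ‖f t‖ ≤ B * ‖g t‖ + B) : MildSingular f := by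
  obtain ⟨C, hC⟩ := hg.2
  refine ⟨hf, B * C + B, fun t ht => (h t ht).trans ?_⟩
  rw [add_mul, mul_assoc]
  exact add_le_add (mul_le_mul_of_nonneg_left (hC t ht) hB)
    (le_mul_of_one_le_right hB (one_le_rpow_mul_one_sub ht))

theorem norm_ofReal_of_mem {t : ℝ} (ht : t ∈ Ioo (0 : ℝ) 1) : ‖(t : ℂ)‖ = t := by
  rw [Complex.norm_real, Real.norm_of_nonneg ht.1.le]

theorem norm_one_sub_ofReal_of_mem {t : ℝ} (ht : t ∈ Ioo (0 : ℝ) 1) :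
    ‖(1 : ℂ) - t‖ = 1 - t := by
  have h2 : (1 : ℂ) - (t : ℂ) = ((1 - t : ℝ) : ℂ) := by push_cast; rfl
  rw [h2, Complex.norm_real, Real.norm_of_nonneg (by linarith [ht.2])]

theorem ofReal_ne_zero_of_mem {t : ℝ} (ht : t ∈ Ioo (0 : ℝ) 1) : (t : ℂ) ≠ 0 := by
  exact_mod_cast ht.1.ne'

theorem one_sub_ofReal_ne_zero_of_mem {t : ℝ} (ht : t ∈ Ioo (0 : ℝ) 1) : (1 : ℂ) - t ≠ 0 := by
  rw [sub_ne_zero]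
  exact_mod_cast ht.2.ne'

theorem mildSingular_logOneSub_div {y : ℂ} (hy : ‖y‖ ≤ 1) :
    MildSingular (fun t => logOneSub y t / t) := by
  refine (mildSingular_logOneSub hy).of_norm_le (B := 2) ?_ two_pos.le fun t ht => ?_
  · exact (continuousOn_logOneSub hy).div (by fun_prop) fun t ht => ofReal_ne_zero_of_mem ht
  rw [norm_div, norm_ofReal_of_mem ht, div_le_iff₀ ht.1]
  have hn := norm_nonneg (logOneSub y t)
  rcases le_or_gt t (1 / 2) with h | h
  · have h1 : ‖-(y * (t : ℂ))‖ ≤ t := by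
      rw [norm_neg, norm_mul, norm_ofReal_of_mem ht]
      exact mul_le_of_le_one_left ht.1.le hy
    have h2 := Complex.norm_log_one_add_half_le_self (h1.trans h)
    rw [← sub_eq_add_neg] at h2
    change ‖logOneSub y t‖ ≤ _ at h2
    nlinarith [ht.1, mul_nonneg hn ht.1.le]
  · nlinarith [ht.1]

theorem norm_logReal_le {t : ℝ} (ht : t ∈ Ioo (1 / 2 : ℝ) 1) : ‖logReal t‖ ≤ 2 * (1 - t) := by
  have h0 : 0 < t := by linarith [ht.1]
  rw [logReal, Complex.norm_real, Real.norm_eq_abs, abs_of_neg (Real.log_neg h0 ht.2)]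
  have h3 := Real.one_sub_inv_le_log_of_pos h0
  have h4 : t⁻¹ - 1 = t⁻¹ * (1 - t) := by
    rw [mul_sub, mul_one, inv_mul_cancel₀ h0.ne']
  have h5 : t⁻¹ ≤ 2 := by
    rw [inv_le_comm₀ h0 two_pos]
    linarith [ht.1]
  nlinarith [ht.2]

theorem mildSingular_logReal_div : MildSingular (fun t => logReal t / (1 - t)) := by
  refine mildSingular_logReal.of_norm_le (B := 2) ?_ two_pos.le fun t ht => ?_
  · exact continuousOn_logReal.div (by fun_prop) fun t ht => one_sub_ofReal_ne_zero_of_mem ht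
  have h1 : 0 < 1 - t := by linarith [ht.2]
  have hn := norm_nonneg (logReal t)
  rw [norm_div, norm_one_sub_ofReal_of_mem ht, div_le_iff₀ h1]
  rcases le_or_gt t (1 / 2) with h | h
  · nlinarith
  · nlinarith [norm_logReal_le ⟨h, ht.2⟩]

theorem one_le_norm_one_sub_mul {y : ℂ} (hy : y.re ≤ 0) {t : ℝ} (ht : 0 ≤ t) :
    1 ≤ ‖1 - y * t‖ := by
  refine le_trans ?_ (Complex.re_le_norm _)
  rw [one_sub_mul_re]
  nlinarith

theorem norm_dlogOneSub_le {y : ℂ} (hy : ‖y‖ ≤ 1) (hre : y.re ≤ 0) {t : ℝ} (ht : 0 ≤ t) :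
    ‖dlogOneSub y t‖ ≤ 1 := by
  rw [dlogOneSub, norm_div, norm_neg]
  exact div_le_one_of_le₀ (hy.trans (one_le_norm_one_sub_mul hre ht)) (norm_nonneg _)

theorem hasDerivAt_logOneSub_of_re_nonpos {y : ℂ} (hre : y.re ≤ 0) {t : ℝ} (ht : 0 ≤ t) :
    HasDerivAt (logOneSub y) (dlogOneSub y t) t := by
  refine hasDerivAt_logOneSub_of_mem (Or.inl ?_)
  rw [one_sub_mul_re]
  nlinarith

theorem norm_logOneSub_sub_le {y : ℂ} (hy : ‖y‖ ≤ 1) (hre : y.re ≤ 0) {t : ℝ}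
    (ht : t ∈ Ioo (0 : ℝ) 1) : ‖logOneSub y t - logOneSub y 1‖ ≤ 1 - t := by
  have h := (convex_Icc (0 : ℝ) 1).norm_image_sub_le_of_norm_hasDerivWithin_le
    (f := logOneSub y) (f' := dlogOneSub y) (C := 1)
    (fun s hs => (hasDerivAt_logOneSub_of_re_nonpos hre hs.1).hasDerivWithinAt)
    (fun s hs => norm_dlogOneSub_le hy hre hs.1) (right_mem_Icc.mpr zero_le_one)
    (Ioo_subset_Icc_self ht)
  rw [one_mul, Real.norm_eq_abs, abs_sub_comm, abs_of_pos (by linarith [ht.2])] at h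
  exact h

theorem mildSingular_logOneSub_sub_div {y : ℂ} (hy : ‖y‖ ≤ 1) (hre : y.re ≤ 0) :
    MildSingular (fun t => (logOneSub y t - logOneSub y 1) / (1 - t)) := by
  refine mildSingular_of_bounded (C := 1) ?_ fun t ht => ?_
  · exact ((continuousOn_logOneSub hy).sub continuousOn_const).div (by fun_prop)
      fun t ht => one_sub_ofReal_ne_zero_of_mem ht
  · rw [norm_div, norm_one_sub_ofReal_of_mem ht]
    exact div_le_one_of_le₀ (norm_logOneSub_sub_le hy hre ht) (by linarith [ht.2])

theorem dlogOneSub_one (t : ℝ) : dlogOneSub 1 t = -(1 - (t : ℂ))⁻¹ := by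
  simp [dlogOneSub, neg_div]

/-- The arguments `y` for which `1 - y t` either is `1 - t` or has real part at least one on the
unit interval. -/
def RegularArg (y : ℂ) : Prop := ‖y‖ ≤ 1 ∧ (y = 1 ∨ y.re ≤ 0)

theorem mildSingular_mul_dlogOneSub {f : ℝ → ℂ} {y : ℂ} (hy : RegularArg y)
    (hf : MildSingular f) (hf' : MildSingular fun t => f t / (1 - t)) :
    MildSingular (fun t => f t * dlogOneSub y t) := by
  rcases hy.2 with rfl | hre
  · refine (hf'.const_mul (-1)).congr fun t _ => ?_
    rw [dlogOneSub_one]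
    ring
  · exact hf.mul_bounded (continuousOn_dlogOneSub hy.1) fun t ht =>
      norm_dlogOneSub_le hy.1 hre ht.1.le

theorem mildSingular_logOneSub_sub {y : ℂ} (hy : ‖y‖ ≤ 1) :
    MildSingular (fun t => logOneSub y t - logOneSub y 1) :=
  (mildSingular_logOneSub hy).sub (mildSingular_const _)

theorem tendsto_logOneSub_one {y : ℂ} (hre : y.re ≤ 0) :
    Tendsto (logOneSub y) (𝓝[<] 1) (𝓝 (logOneSub y 1)) :=
  (hasDerivAt_logOneSub_of_re_nonpos hre zero_le_one).continuousAt.tendsto.mono_left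
    nhdsWithin_le_nhds

theorem tendsto_logOneSub_zero {y : ℂ} : Tendsto (logOneSub y) (𝓝[>] 0) (𝓝 0) := by
  have h : HasDerivAt (logOneSub y) (dlogOneSub y 0) 0 :=
    hasDerivAt_logOneSub_of_mem (by simp)
  have h1 := h.continuousAt.tendsto
  have h2 : logOneSub y 0 = 0 := by simp [logOneSub]
  rw [h2] at h1
  exact h1.mono_left nhdsWithin_le_nhds

theorem hasUnitIntegral_neg_mul_of_hasDerivAt {F B B' G G' : ℝ → ℂ} {v : ℂ}
    (hF : ∀ t ∈ Ioo (0 : ℝ) 1, HasDerivAt F (B' t * G t) t)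
    (hB : ∀ t ∈ Ioo (0 : ℝ) 1, HasDerivAt B (B' t) t)
    (hG : ∀ t ∈ Ioo (0 : ℝ) 1, HasDerivAt G (G' t) t)
    (hBG : IntegrableOn (fun t => B t * G' t) (Ioo 0 1))
    (hF0 : Tendsto F (𝓝[>] 0) (𝓝 0)) (hBG0 : Tendsto (fun t => B t * G t) (𝓝[>] 0) (𝓝 0))
    (hF1 : Tendsto F (𝓝[<] 1) (𝓝 v)) (hBG1 : Tendsto (fun t => B t * G t) (𝓝[<] 1) (𝓝 0)) :
    HasUnitIntegral (fun t => -(B t * G' t)) v := by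
  have h := hasUnitIntegral_of_hasDerivAt (F := fun t => F t - B t * G t)
    (f := fun t => -(B t * G' t)) hBG.neg
    (fun t ht => ((hF t ht).sub ((hB t ht).mul (hG t ht))).congr_deriv (by ring))
    (hF0.sub hBG0) (hF1.sub hBG1)
  simpa using h

theorem tendsto_mpvGen_zero {s : ℕ} {z : ℂ} {t : List (ℕ × ℂ)}
    (h : AdmissibleWord ((s, z) :: t)) (u : ℂ) :
    Tendsto (fun x : ℝ => mpvGen ((s, z) :: t) (u * x)) (𝓝[>] 0) (𝓝 0) := by
  obtain ⟨B, hB⟩ := exists_norm_mpvCoeff_le h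
  obtain ⟨D, hD, -⟩ := hasDerivAt_tsum_mul_pow hB (x := 0) (by simp)
  have h1 : Tendsto (mpvGen ((s, z) :: t)) (𝓝 0) (𝓝 0) := by
    have := hD.continuousAt.tendsto
    change Tendsto _ _ (𝓝 (mpvGen ((s, z) :: t) 0)) at this
    rwa [mpvGen_cons_zero h.head.1] at this
  have h2 : Tendsto (fun x : ℝ => u * (x : ℂ)) (𝓝[>] 0) (𝓝 0) := by
    have : Continuous fun x : ℝ => u * (x : ℂ) := by fun_prop
    simpa using (this.tendsto 0).mono_left nhdsWithin_le_nhds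
  exact h1.comp h2

theorem tendsto_mul_mpvGen_one {s : ℕ} {z : ℂ} {t : List (ℕ × ℂ)}
    (h : AdmissibleWord ((s, z) :: t)) {u : ℂ} (hu : ‖u‖ ≤ 1) {B : ℝ → ℂ} {C : ℝ}
    (hB : ∀ x ∈ Ioo (1 / 2 : ℝ) 1, ‖B x‖ ≤ C * (1 - x)) :
    Tendsto (fun x : ℝ => B x * mpvGen ((s, z) :: t) (u * x)) (𝓝[<] 1) (𝓝 0) := by
  have h1 := (tendsto_one_sub_mul_mpvGen h hu).norm.const_mul C
  rw [norm_zero, mul_zero] at h1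
  refine squeeze_zero_norm' ?_ h1
  filter_upwards [Ioo_mem_nhdsLT (show (1 / 2 : ℝ) < 1 by norm_num)] with x hx
  have hx' : x ∈ Ioo (0 : ℝ) 1 := ⟨by linarith [hx.1], hx.2⟩
  rw [norm_mul, norm_mul, norm_one_sub_ofReal_of_mem hx', ← mul_assoc]
  exact mul_le_mul_of_nonneg_right (hB x hx) (norm_nonneg _)

theorem norm_ofReal_lt_one_of_mem {t : ℝ} (ht : t ∈ Ioo (0 : ℝ) 1) : ‖(t : ℂ)‖ < 1 := by
  rw [norm_ofReal_of_mem ht]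
  exact ht.2

theorem hasDerivAt_mpvGen_one_cons_ofReal {z u : ℂ} {l : List (ℕ × ℂ)}
    (h : AdmissibleWord ((1, z) :: l)) (hu : ‖u‖ ≤ 1) {t : ℝ} (ht : t ∈ Ioo (0 : ℝ) 1) :
    HasDerivAt (fun x : ℝ => mpvGen ((1, z) :: l) (u * x))
      (-dlogOneSub (u * z) t * mpvGen l (u * z * t)) t := by
  have h1 : HasDerivAt (fun x : ℝ => u * (x : ℂ)) u t := by
    simpa using ((hasDerivAt_id (t : ℂ)).comp_ofReal.const_mul u)
  have h2 := (hasDerivAt_mpvGen_one_cons h (norm_mul_lt_one hu (norm_ofReal_lt_one_of_mem ht)))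
  refine (h2.comp t h1).congr_deriv ?_
  rw [dlogOneSub, show z * (u * (t : ℂ)) = u * z * t by ring]
  ring

theorem hasDerivAt_mpvGen_two_cons_ofReal {z u : ℂ} {l : List (ℕ × ℂ)}
    (h : AdmissibleWord ((2, z) :: l)) (hu : ‖u‖ ≤ 1) (hu0 : u ≠ 0) {t : ℝ}
    (ht : t ∈ Ioo (0 : ℝ) 1) :
    HasDerivAt (fun x : ℝ => mpvGen ((2, z) :: l) (u * x))
      (mpvGen ((1, z) :: l) (u * t) / t) t := by
  have h1 : HasDerivAt (fun x : ℝ => u * (x : ℂ)) u t := by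
    simpa using ((hasDerivAt_id (t : ℂ)).comp_ofReal.const_mul u)
  have h0 := ofReal_ne_zero_of_mem ht
  have h2 := (hasDerivAt_mpvGen_two_cons h (norm_mul_lt_one hu (norm_ofReal_lt_one_of_mem ht))
    (mul_ne_zero hu0 h0))
  refine (h2.comp t h1).congr_deriv ?_
  field_simp

theorem mpvGen_singleton_ofReal {z u : ℂ} (hz : ‖z‖ ≤ 1) (hu : ‖u‖ ≤ 1) {t : ℝ}
    (ht : t ∈ Ioo (0 : ℝ) 1) : mpvGen [(1, z)] (u * t) = -logOneSub (u * z) t := by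
  rw [mpvGen_singleton hz (norm_mul_lt_one hu (norm_ofReal_lt_one_of_mem ht)), logOneSub]
  congr 3
  ring

theorem admissibleWord_singleton {s : ℕ} {z : ℂ} (hs : 0 < s) (hz : ‖z‖ ≤ 1) :
    AdmissibleWord [(s, z)] :=
  admissibleWord_nil.cons hs hz

theorem norm_mul_le_one {z w : ℂ} (hz : ‖z‖ ≤ 1) (hw : ‖w‖ ≤ 1) : ‖z * w‖ ≤ 1 := by
  rw [norm_mul]
  exact mul_le_one₀ hz (norm_nonneg _) hw

theorem ne_one_of_re_nonpos {z : ℂ} (hre : z.re ≤ 0) : z ≠ 1 := by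
  rintro rfl
  norm_num at hre

theorem Li_one_singleton {z : ℂ} (hz : ‖z‖ ≤ 1) (hre : z.re ≤ 0) :
    Li [(1, z)] = -logOneSub z 1 := by
  have h := tendsto_mpvGen_Li (Or.inr (ne_one_of_re_nonpos hre))
    (admissibleWord_singleton one_pos hz)
  refine tendsto_nhds_unique h ((tendsto_logOneSub_one hre).neg.congr' ?_)
  filter_upwards [Ioo_mem_nhdsLT (show (0 : ℝ) < 1 by norm_num)] with x hx
  have := mpvGen_singleton_ofReal hz (u := 1) (by simp) hx
  rw [one_mul, one_mul] at this
  exact this.symm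

theorem hasUnitIntegral_Li_one_one {u v : ℂ} (hu : ‖u‖ ≤ 1) (hre : u.re ≤ 0) (hv : ‖v‖ ≤ 1) :
    HasUnitIntegral (fun t => logOneSub (u * v) t * dlogOneSub u t) (Li [(1, u), (1, v)]) := by
  have hA := (admissibleWord_singleton one_pos hv).cons one_pos hu
  have huv := norm_mul_le_one hu hv
  have h0 := tendsto_mpvGen_zero hA 1
  simp only [one_mul] at h0
  rw [← sub_zero (Li _)]
  refine hasUnitIntegral_of_hasDerivAt ?_ (fun t ht => ?_) h0
    (tendsto_mpvGen_Li (Or.inr (ne_one_of_re_nonpos hre)) hA)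
  · exact (mildSingular_logOneSub huv).integrableOn_mul (mildSingular_of_bounded
      (continuousOn_dlogOneSub hu) fun t ht => norm_dlogOneSub_le hu hre ht.1.le)
  · have h1 := hasDerivAt_mpvGen_one_cons_ofReal hA (u := 1) (by simp) ht
    simp only [one_mul] at h1
    refine h1.congr_deriv ?_
    rw [mpvGen_singleton_ofReal hv hu ht]
    ring

theorem tendsto_logOneSub_sub_mul_zero {y : ℂ} {G : ℝ → ℂ} (hG : Tendsto G (𝓝[>] 0) (𝓝 0)) :
    Tendsto (fun t => (logOneSub y t - logOneSub y 1) * G t) (𝓝[>] 0) (𝓝 0) := by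
  simpa using (tendsto_logOneSub_zero.sub_const (logOneSub y 1)).mul hG

theorem hasUnitIntegral_Li_one_one_one {z₁ z₂ z₃ : ℂ} (h₁ : ‖z₁‖ ≤ 1) (hre : z₁.re ≤ 0)
    (h₃ : ‖z₃‖ ≤ 1) (h₂ : ‖z₂‖ ≤ 1) (h₁₂ : RegularArg (z₁ * z₂)) :
    HasUnitIntegral (fun t => (logOneSub z₁ t - logOneSub z₁ 1) * logOneSub (z₁ * z₂ * z₃) t *
      dlogOneSub (z₁ * z₂) t) (Li [(1, z₁), (1, z₂), (1, z₃)]) := by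
  have hA' := (admissibleWord_singleton one_pos h₃).cons one_pos h₂
  have hA := hA'.cons one_pos h₁
  have hy := norm_mul_le_one h₁₂.1 h₃
  have h0 := tendsto_mpvGen_zero hA 1
  simp only [one_mul] at h0
  refine (hasUnitIntegral_neg_mul_of_hasDerivAt (F := fun x : ℝ => mpvGen _ x)
    (B := fun t => logOneSub z₁ t - logOneSub z₁ 1) (B' := dlogOneSub z₁)
    (G := fun t => -mpvGen [(1, z₂), (1, z₃)] (z₁ * t))
    (G' := fun t => -(logOneSub (z₁ * z₂ * z₃) t * dlogOneSub (z₁ * z₂) t))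
    (fun t ht => ?_) (fun t ht => (hasDerivAt_logOneSub h₁ ht).sub_const _) (fun t ht => ?_) ?_ h0
    ?_ (tendsto_mpvGen_Li (Or.inr (ne_one_of_re_nonpos hre)) hA) ?_).congr fun t _ => by ring
  · have h1 := hasDerivAt_mpvGen_one_cons_ofReal hA (u := 1) (by simp) ht
    simp only [one_mul] at h1
    exact h1.congr_deriv (by ring)
  · refine (hasDerivAt_mpvGen_one_cons_ofReal hA' h₁ ht).neg.congr_deriv ?_
    rw [mpvGen_singleton_ofReal h₃ h₁₂.1 ht]
    ring
  · refine ((mildSingular_mul_dlogOneSub h₁₂ (mildSingular_logOneSub_sub h₁)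
      (mildSingular_logOneSub_sub_div h₁ hre)).integrableOn_mul
      ((mildSingular_logOneSub hy).const_mul (-1))).congr_fun (fun t _ => ?_) measurableSet_Ioo
    ring
  · simpa using (tendsto_logOneSub_sub_mul_zero (y := z₁) (tendsto_mpvGen_zero hA' z₁)).neg
  · have := (tendsto_mul_mpvGen_one hA' h₁ (B := fun t => logOneSub z₁ t - logOneSub z₁ 1)
      (C := 1) fun x hx => ?_).neg
    · simpa using this
    · rw [one_mul]
      exact norm_logOneSub_sub_le h₁ hre ⟨by linarith [hx.1], hx.2⟩

theorem hasUnitIntegral_Li_one_two {z₁ z₂ : ℂ} (h₁ : ‖z₁‖ ≤ 1) (h₁0 : z₁ ≠ 0)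
    (hre : z₁.re ≤ 0) (h₂ : ‖z₂‖ ≤ 1) :
    HasUnitIntegral (fun t => -((logOneSub z₁ t - logOneSub z₁ 1) * logOneSub (z₁ * z₂) t *
      (1 / (t : ℂ)))) (Li [(1, z₁), (2, z₂)]) := by
  have hA' := admissibleWord_singleton two_pos h₂
  have hA := hA'.cons one_pos h₁
  have hy := norm_mul_le_one h₁ h₂
  have h0 := tendsto_mpvGen_zero hA 1
  simp only [one_mul] at h0
  refine (hasUnitIntegral_neg_mul_of_hasDerivAt (F := fun x : ℝ => mpvGen _ x)
    (B := fun t => logOneSub z₁ t - logOneSub z₁ 1) (B' := dlogOneSub z₁)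
    (G := fun t => -mpvGen [(2, z₂)] (z₁ * t))
    (G' := fun t => logOneSub (z₁ * z₂) t / t)
    (fun t ht => ?_) (fun t ht => (hasDerivAt_logOneSub h₁ ht).sub_const _) (fun t ht => ?_) ?_ h0
    ?_ (tendsto_mpvGen_Li (Or.inr (ne_one_of_re_nonpos hre)) hA) ?_).congr fun t _ => by ring
  · have h1 := hasDerivAt_mpvGen_one_cons_ofReal hA (u := 1) (by simp) ht
    simp only [one_mul] at h1
    exact h1.congr_deriv (by ring)
  · refine (hasDerivAt_mpvGen_two_cons_ofReal hA' h₁ h₁0 ht).neg.congr_deriv ?_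
    rw [mpvGen_singleton_ofReal h₂ h₁ ht]
    ring
  · exact (mildSingular_logOneSub_sub h₁).integrableOn_mul (mildSingular_logOneSub_div hy)
  · simpa using (tendsto_logOneSub_sub_mul_zero (y := z₁) (tendsto_mpvGen_zero hA' z₁)).neg
  · have := (tendsto_mul_mpvGen_one hA' h₁ (B := fun t => logOneSub z₁ t - logOneSub z₁ 1)
      (C := 1) fun x hx => ?_).neg
    · simpa using this
    · rw [one_mul]
      exact norm_logOneSub_sub_le h₁ hre ⟨by linarith [hx.1], hx.2⟩

theorem hasUnitIntegral_Li_two_one {z₁ z₂ : ℂ} (hz₁ : RegularArg z₁) (h₂ : ‖z₂‖ ≤ 1) :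
    HasUnitIntegral (fun t => -(logReal t * logOneSub (z₁ * z₂) t * dlogOneSub z₁ t))
      (Li [(2, z₁), (1, z₂)]) := by
  have h₁ := hz₁.1
  have hA'' := admissibleWord_singleton one_pos h₂
  have hA' := hA''.cons one_pos h₁
  have hA := hA''.cons two_pos h₁
  have hy := norm_mul_le_one h₁ h₂
  have h0 := tendsto_mpvGen_zero hA 1
  simp only [one_mul] at h0
  refine (hasUnitIntegral_neg_mul_of_hasDerivAt (F := fun x : ℝ => mpvGen _ x)
    (B := logReal) (B' := fun t => 1 / (t : ℂ))
    (G := fun t => mpvGen [(1, z₁), (1, z₂)] t)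
    (G' := fun t => logOneSub (z₁ * z₂) t * dlogOneSub z₁ t)
    (fun t ht => ?_) (fun t ht => hasDerivAt_logReal ht) (fun t ht => ?_) ?_ h0
    ?_ (tendsto_mpvGen_Li (Or.inl le_rfl) hA) ?_).congr fun t _ => by ring
  · have h1 := hasDerivAt_mpvGen_two_cons_ofReal hA (u := 1) (by simp) one_ne_zero ht
    simp only [one_mul] at h1
    exact h1.congr_deriv (by ring)
  · have h1 := hasDerivAt_mpvGen_one_cons_ofReal hA' (u := 1) (by simp) ht
    simp only [one_mul] at h1
    refine h1.congr_deriv ?_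
    rw [mpvGen_singleton_ofReal h₂ h₁ ht]
    ring
  · refine ((mildSingular_mul_dlogOneSub hz₁ mildSingular_logReal
      mildSingular_logReal_div).integrableOn_mul
      (mildSingular_logOneSub hy)).congr_fun (fun t _ => ?_) measurableSet_Ioo
    ring
  · have hD := (hasDerivAt_mpvGen_one_cons hA' (x := 0) (by simp)).isBigO_sub
    rw [mpvGen_cons_zero one_pos] at hD
    simp only [sub_zero] at hD
    have h2 : Tendsto (fun x : ℝ => (x : ℂ)) (𝓝[>] 0) (𝓝 0) := by
      have := (Complex.continuous_ofReal.tendsto 0).mono_left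
        (nhdsWithin_le_nhds (s := Ioi (0 : ℝ)))
      rwa [Complex.ofReal_zero] at this
    have h3 := (Asymptotics.isBigO_refl logReal (𝓝[>] 0)).mul (hD.comp_tendsto h2)
    refine h3.trans_tendsto ?_
    have h4 := (tendsto_log_mul_rpow_nhdsGT_zero one_pos)
    simp only [Real.rpow_one] at h4
    have h5 := (Complex.continuous_ofReal.tendsto 0).comp h4
    rw [Complex.ofReal_zero] at h5
    exact h5.congr fun x => by simp [logReal]
  · have := tendsto_mul_mpvGen_one hA' (u := 1) (by simp) (B := logReal)
      (C := 2) fun x hx => norm_logReal_le hx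
    simpa using this

theorem mpvPartial_cons_zero (q : ℕ × ℂ) (l : List (ℕ × ℂ)) : mpvPartial (q :: l) 0 = 0 := by
  simp [mpvPartial]

theorem mpvPartial_cons_one (q : ℕ × ℂ) (l : List (ℕ × ℂ)) : mpvPartial (q :: l) 1 = 0 := by
  simp [mpvPartial]

theorem mpvPartial_cons_succ (s : ℕ) (z : ℂ) (l : List (ℕ × ℂ)) {m : ℕ} (hm : 1 ≤ m) :
    mpvPartial ((s, z) :: l) (m + 1)
      = mpvPartial ((s, z) :: l) m + z ^ m / (m : ℂ) ^ s * mpvPartial l m :=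
  Finset.sum_Ico_succ_top hm _

theorem mpvPartial_mul_one_one (z v : ℂ) (m : ℕ) :
    mpvPartial [(1, z)] m * mpvPartial [(1, v)] m
      = mpvPartial [(1, z), (1, v)] m + mpvPartial [(1, v), (1, z)] m
        + mpvPartial [(2, z * v)] m := by
  induction m with
  | zero => simp [mpvPartial_cons_zero]
  | succ m ih =>
    rcases Nat.eq_zero_or_pos m with rfl | hm
    · simp [mpvPartial_cons_one]
    · have hm' : (m : ℂ) ≠ 0 := by exact_mod_cast hm.ne'
      simp only [mpvPartial_cons_succ _ _ _ hm, mul_pow, show ∀ n, mpvPartial [] n = 1 from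
        fun _ => rfl]
      linear_combination ih

theorem mpvPartial_mul_one_one_one (z u v : ℂ) (m : ℕ) :
    mpvPartial [(1, z)] m * mpvPartial [(1, u), (1, v)] m
      = mpvPartial [(1, z), (1, u), (1, v)] m + mpvPartial [(1, u), (1, z), (1, v)] m
        + mpvPartial [(1, u), (1, v), (1, z)] m + mpvPartial [(2, z * u), (1, v)] m
        + mpvPartial [(1, u), (2, z * v)] m := by
  induction m with
  | zero => simp [mpvPartial_cons_zero]
  | succ m ih =>
    rcases Nat.eq_zero_or_pos m with rfl | hm
    · simp [mpvPartial_cons_one]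
    · rw [mpvPartial_cons_succ 1 z [] hm, mpvPartial_cons_succ 1 u [(1, v)] hm,
        mpvPartial_cons_succ 1 z [(1, u), (1, v)] hm, mpvPartial_cons_succ 1 u [(1, z), (1, v)] hm,
        mpvPartial_cons_succ 1 u [(1, v), (1, z)] hm, mpvPartial_cons_succ 2 (z * u) [(1, v)] hm,
        mpvPartial_cons_succ 1 u [(2, z * v)] hm, mul_pow z u, show mpvPartial [] m = 1 from rfl]
      linear_combination ih + u ^ m / (m : ℂ) ^ 1 * mpvPartial_mul_one_one z v m

theorem Li_mul_Li_one_one {z u v : ℂ} (hz : ‖z‖ ≤ 1) (hzr : z.re ≤ 0) (hu : ‖u‖ ≤ 1)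
    (hur : u.re ≤ 0) (hv : ‖v‖ ≤ 1) :
    Li [(1, z)] * Li [(1, u), (1, v)]
      = Li [(1, z), (1, u), (1, v)] + Li [(1, u), (1, z), (1, v)] + Li [(1, u), (1, v), (1, z)]
        + Li [(2, z * u), (1, v)] + Li [(1, u), (2, z * v)] := by
  have hz1 := ne_one_of_re_nonpos hzr
  have hu1 := ne_one_of_re_nonpos hur
  have hz' := admissibleWord_singleton one_pos hz
  have hv' := admissibleWord_singleton one_pos hv
  have h1 := tendsto_mpvPartial_Li (Or.inr hz1) hz'
  have h2 := tendsto_mpvPartial_Li (Or.inr hu1) (hv'.cons one_pos hu)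
  have h3 := tendsto_mpvPartial_Li (Or.inr hz1) ((hv'.cons one_pos hu).cons one_pos hz)
  have h4 := tendsto_mpvPartial_Li (Or.inr hu1) ((hv'.cons one_pos hz).cons one_pos hu)
  have h5 := tendsto_mpvPartial_Li (Or.inr hu1) ((hz'.cons one_pos hv).cons one_pos hu)
  have h6 := tendsto_mpvPartial_Li (Or.inl le_rfl) (hv'.cons two_pos (norm_mul_le_one hz hu))
  have h7 := tendsto_mpvPartial_Li (Or.inr hu1)
    ((admissibleWord_singleton two_pos (norm_mul_le_one hz hv)).cons one_pos hu)
  exact tendsto_nhds_unique ((h1.mul h2).congr fun m => mpvPartial_mul_one_one_one z u v m)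
    ((((h3.add h4).add h5).add h6).add h7)

theorem hasUnitIntegral_stuffle {z u v p q w : ℂ} (hz : ‖z‖ ≤ 1) (hzr : z.re ≤ 0)
    (hu : ‖u‖ ≤ 1) (hur : u.re ≤ 0) (hu0 : u ≠ 0) (hv : ‖v‖ ≤ 1) (hp : RegularArg p)
    (hq : RegularArg q) (hpe : z * u = p) (hqe : u * v = q) (hwe : z * u * v = w) :
    HasUnitIntegral (fun t =>
      (logOneSub z t - logOneSub z 1) * logOneSub w t * dlogOneSub p t
      + (logOneSub u t - logOneSub u 1) * logOneSub w t * dlogOneSub p t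
      + (logOneSub u t - logOneSub u 1) * logOneSub w t * dlogOneSub q t
      + -(logReal t * logOneSub w t * dlogOneSub p t)
      + -((logOneSub u t - logOneSub u 1) * logOneSub w t * (1 / (t : ℂ)))
      + logOneSub z 1 * (logOneSub q t * dlogOneSub u t)) 0 := by
  have hp' : RegularArg (u * z) := by rwa [mul_comm, hpe]
  have h1 := hasUnitIntegral_Li_one_one_one hz hzr hv hu (hpe ▸ hp)
  have h2 := hasUnitIntegral_Li_one_one_one hu hur hv hz hp'
  have h3 := hasUnitIntegral_Li_one_one_one hu hur hz hv (hqe ▸ hq)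
  have h4 := hasUnitIntegral_Li_two_one (z₁ := z * u) (hpe ▸ hp) hv
  have h5 := hasUnitIntegral_Li_one_two hu hu0 hur (norm_mul_le_one hz hv)
  have h6 := (hasUnitIntegral_Li_one_one hu hur hv).const_mul (logOneSub z 1)
  have e1 : u * z = p := by rw [mul_comm, hpe]
  have e2 : u * v * z = w := by rw [← hwe]; ring
  have e3 : u * (z * v) = w := by rw [← hwe]; ring
  have e4 : p * v = w := by rw [← hpe, hwe]
  rw [hpe, e4] at h1
  rw [e1, e4] at h2
  rw [hqe, ← hqe, e2, hqe] at h3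
  rw [hpe, e4] at h4
  rw [e3] at h5
  rw [hqe] at h6
  have h7 := Li_mul_Li_one_one hz hzr hu hur hv
  rw [Li_one_singleton hz hzr, hpe] at h7
  have h8 := ((((h1.add h2).add h3).add h4).add h5).add h6
  rwa [← h7, neg_mul, neg_add_cancel] at h8

theorem Li_two_one_singleton : Li [(2, 1)] = (Real.pi : ℂ) ^ 2 / 6 := by
  have h1 := tendsto_mpvPartial_Li (Or.inl le_rfl)
    (admissibleWord_singleton (z := 1) two_pos (by simp))
  have h2 := (hasSum_zeta_two.tendsto_sum_nat).ofReal
  push_cast at h2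
  refine tendsto_nhds_unique h1 (h2.congr' ?_)
  filter_upwards [eventually_ge_atTop 1] with m hm
  rw [mpvPartial_eq_sum_mpvCoeff (admissibleWord_singleton two_pos (by simp)) hm]
  refine Finset.sum_congr rfl fun n _ => ?_
  simp [mpvCoeff, mpvPartial]

theorem hasUnitIntegral_log_one_sub_div :
    HasUnitIntegral (fun t => logOneSub 1 t * (1 / (t : ℂ))) (-((Real.pi : ℂ) ^ 2 / 6)) := by
  have hA := admissibleWord_singleton (z := 1) two_pos (by simp)
  have h0 := (tendsto_mpvGen_zero hA 1).neg
  simp only [one_mul] at h0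
  have h1 := (tendsto_mpvGen_Li (Or.inl le_rfl) hA).neg
  rw [Li_two_one_singleton] at h1
  have := hasUnitIntegral_of_hasDerivAt (f := fun t => logOneSub 1 t * (1 / (t : ℂ))) ?_
    (fun t ht => ?_) h0 h1
  · simpa using this
  · exact ((mildSingular_logOneSub_div (y := 1) (by simp)).integrableOn_mul
      (mildSingular_const 1)).congr_fun (fun t _ => by ring) measurableSet_Ioo
  · have h2 := (hasDerivAt_mpvGen_two_cons_ofReal hA (u := 1) (by simp) one_ne_zero ht).neg
    rw [mpvGen_singleton_ofReal (by simp) (by simp) ht] at h2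
    simp only [one_mul] at h2
    exact h2.congr_deriv (by ring)

theorem log_mul_of_re_pos {x y : ℂ} (hx : 0 < x.re) (hy : 0 ≤ y.re) (hy0 : y ≠ 0) :
    Complex.log (x * y) = Complex.log x + Complex.log y := by
  have hx0 : x ≠ 0 := by
    rintro rfl
    simp at hx
  refine (Complex.log_mul_eq_add_log_iff hx0 hy0).mpr ?_
  have h1 := abs_lt.mp (Complex.abs_arg_lt_pi_div_two_iff.mpr (Or.inl hx))
  have h2 := abs_le.mp (Complex.abs_arg_le_pi_div_two_iff.mpr hy)
  constructor <;> linarith [h1.1, h1.2, h2.1, h2.2]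

theorem log_add_log_eq {x y z w : ℂ} (hx : 0 < x.re) (hy : 0 < y.re) (hz : 0 < z.re)
    (hw : 0 < w.re) (h : x * y = z * w) :
    Complex.log x + Complex.log y = Complex.log z + Complex.log w := by
  have h0 : ∀ u : ℂ, 0 < u.re → u ≠ 0 := by
    rintro u hu rfl
    simp at hu
  rw [← log_mul_of_re_pos hx hy.le (h0 y hy), h, log_mul_of_re_pos hz hw.le (h0 w hw)]

theorem logReal_eq_log {t : ℝ} (ht : 0 ≤ t) : logReal t = Complex.log t :=
  Complex.ofReal_log ht

theorem logOneSub_neg_one_one :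
    logOneSub (-1) 1 = logOneSub Complex.I 1 + logOneSub (-Complex.I) 1 := by
  have := log_add_log_eq (x := 1 - (-1) * (1 : ℝ)) (y := 1) (z := 1 - Complex.I * (1 : ℝ))
    (w := 1 - -Complex.I * (1 : ℝ)) (by simp) (by simp) (by simp) (by simp) (by
      push_cast
      linear_combination Complex.I_sq)
  rwa [Complex.log_one, add_zero] at this

theorem logOneSub_I_one_sub_sq :
    (logOneSub Complex.I 1 - logOneSub (-Complex.I) 1) ^ 2 = -((Real.pi : ℂ) ^ 2 / 4) := by
  have h1 := log_mul_of_re_pos (x := 1 - Complex.I * (1 : ℝ)) (y := Complex.I) (by simp) (by simp)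
    Complex.I_ne_zero
  have h2 : (1 - Complex.I * (1 : ℝ)) * Complex.I = 1 - -Complex.I * (1 : ℝ) := by
    push_cast
    linear_combination -Complex.I_sq
  rw [h2, Complex.log_I] at h1
  have h3 : logOneSub Complex.I 1 - logOneSub (-Complex.I) 1 = -(Real.pi / 2 * Complex.I) := by
    rw [logOneSub, logOneSub, h1]
    ring
  rw [h3]
  linear_combination (Real.pi : ℂ) ^ 2 / 4 * Complex.I_sq

section Substitution

variable {t : ℝ}

theorem one_sub_re_pos {y : ℂ} (hy : ‖y‖ ≤ 1) (ht : t ∈ Ioo (0 : ℝ) 1) :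
    0 < (1 - y * t).re := by
  rw [one_sub_mul_re]
  have := (Complex.re_le_norm y).trans hy
  nlinarith [ht.1, ht.2]

theorem sq_mem_Ioo (ht : t ∈ Ioo (0 : ℝ) 1) : t ^ 2 ∈ Ioo (0 : ℝ) 1 :=
  ⟨pow_pos ht.1 2, by nlinarith [ht.1, ht.2]⟩

theorem logReal_sq (t : ℝ) : logReal (t ^ 2) = 2 * logReal t := by
  simp [logReal, Real.log_pow]

theorem logOneSub_sq {y z : ℂ} (hy : ‖y‖ ≤ 1) (hz : z ^ 2 = y) (ht : t ∈ Ioo (0 : ℝ) 1) :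
    logOneSub y (t ^ 2) = logOneSub z t + logOneSub (-z) t := by
  have hz1 : ‖z‖ ≤ 1 := by
    rw [← hz, norm_pow] at hy
    exact (pow_le_one_iff_of_nonneg (norm_nonneg z) two_ne_zero).mp hy
  have := log_add_log_eq (x := 1 - y * (t ^ 2 : ℝ)) (y := 1) (one_sub_re_pos hy (sq_mem_Ioo ht))
    (by simp) (one_sub_re_pos hz1 ht) (one_sub_re_pos (y := -z) (by rwa [norm_neg]) ht) (by
      push_cast
      linear_combination (t : ℂ) ^ 2 * hz)
  rwa [Complex.log_one, add_zero] at this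

theorem dlogOneSub_sq {y z : ℂ} (hy : ‖y‖ ≤ 1) (hz : z ^ 2 = y) (ht : t ∈ Ioo (0 : ℝ) 1) :
    2 * (t : ℂ) * dlogOneSub y (t ^ 2) = dlogOneSub z t + dlogOneSub (-z) t := by
  have hz1 : ‖z‖ ≤ 1 := by
    rw [← hz, norm_pow] at hy
    exact (pow_le_one_iff_of_nonneg (norm_nonneg z) two_ne_zero).mp hy
  have h2 := Complex.slitPlane_ne_zero (one_sub_mul_mem_slitPlane hz1 ht)
  have h3 := Complex.slitPlane_ne_zero
    (one_sub_mul_mem_slitPlane (y := -z) (by rwa [norm_neg]) ht)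
  simp only [dlogOneSub]
  subst hz
  rw [show 1 - z ^ 2 * ((t ^ 2 : ℝ) : ℂ) = (1 - z * t) * (1 - -z * t) by push_cast; ring,
    div_add_div _ _ h2 h3, ← mul_div_assoc]
  congr 1
  ring

theorem ofReal_one_sub_div_one_add_mul (ht : t ∈ Ioo (0 : ℝ) 1) :
    (((1 - t) / (1 + t) : ℝ) : ℂ) * (1 - -1 * t) = 1 - 1 * t := by
  have : (1 : ℂ) + t ≠ 0 := by
    have h : (1 : ℝ) + t ≠ 0 := by linarith [ht.1]
    exact_mod_cast h
  push_cast
  field_simp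
  ring

theorem logReal_one_sub_div_one_add (ht : t ∈ Ioo (0 : ℝ) 1) :
    logReal ((1 - t) / (1 + t)) = logOneSub 1 t - logOneSub (-1) t := by
  have h := one_sub_div_one_add_mem ht
  have := log_add_log_eq (x := ((1 - t) / (1 + t) : ℝ)) (y := 1 - -1 * t) (z := 1 - 1 * t) (w := 1)
    (by rw [Complex.ofReal_re]; exact h.1) (one_sub_re_pos (by simp) ht)
    (one_sub_re_pos (by simp) ht) (by simp) (by
      rw [ofReal_one_sub_div_one_add_mul ht, mul_one])
  rw [Complex.log_one, add_zero] at this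
  rw [logReal_eq_log h.1.le, logOneSub, logOneSub, ← this]
  ring

theorem logOneSub_one_sub_div_one_add {y z : ℂ} (hy : ‖y‖ ≤ 1) (hre : y.re ≤ 0) (hz : ‖z‖ ≤ 1)
    (hyz : 1 + y = -z * (1 - y)) (ht : t ∈ Ioo (0 : ℝ) 1) :
    logOneSub y ((1 - t) / (1 + t)) = logOneSub y 1 + logOneSub z t - logOneSub (-1) t := by
  have h := one_sub_div_one_add_mem ht
  have := log_add_log_eq (x := 1 - y * ((1 - t) / (1 + t) : ℝ)) (y := 1 - -1 * t)
    (z := 1 - y * (1 : ℝ)) (w := 1 - z * t) (one_sub_re_pos hy h)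
    (one_sub_re_pos (by simp) ht) (by simp; linarith)
    (one_sub_re_pos hz ht) (by
      push_cast
      have h2 := ofReal_one_sub_div_one_add_mul ht
      push_cast at h2
      linear_combination -y * h2 + (t : ℂ) * hyz)
  simp only [logOneSub]
  rw [← this]
  ring

theorem logOneSub_one_one_sub_div_one_add (ht : t ∈ Ioo (0 : ℝ) 1) :
    logOneSub 1 ((1 - t) / (1 + t)) = logOneSub (-1) 1 + logReal t - logOneSub (-1) t := by
  have h := one_sub_div_one_add_mem ht
  have := log_add_log_eq (x := 1 - 1 * ((1 - t) / (1 + t) : ℝ)) (y := 1 - -1 * t)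
    (z := 1 - (-1) * (1 : ℝ)) (w := t) (one_sub_re_pos (by simp) h)
    (one_sub_re_pos (by simp) ht) (by simp)
    (by rw [Complex.ofReal_re]; exact ht.1) (by
      push_cast
      have h2 := ofReal_one_sub_div_one_add_mul ht
      push_cast at h2
      linear_combination -h2)
  rw [logReal_eq_log ht.1.le]
  simp only [logOneSub]
  rw [← this]
  ring

theorem inv_one_sub_div_one_add (ht : t ∈ Ioo (0 : ℝ) 1) :
    2 / (1 + (t : ℂ)) ^ 2 * (1 / (((1 - t) / (1 + t) : ℝ) : ℂ))
      = dlogOneSub (-1) t - dlogOneSub 1 t := by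
  have h1 : (1 : ℂ) + t ≠ 0 := by
    have h : (1 : ℝ) + t ≠ 0 := by linarith [ht.1]
    exact_mod_cast h
  have h2 := one_sub_ofReal_ne_zero_of_mem ht
  simp only [dlogOneSub]
  push_cast
  rw [show (1 : ℂ) - -1 * t = 1 + t by ring, one_mul]
  field_simp
  ring

theorem dlogOneSub_one_one_sub_div_one_add (ht : t ∈ Ioo (0 : ℝ) 1) :
    2 / (1 + (t : ℂ)) ^ 2 * dlogOneSub 1 ((1 - t) / (1 + t))
      = dlogOneSub (-1) t - 1 / (t : ℂ) := by
  have h1 : (1 : ℂ) + t ≠ 0 := by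
    have h : (1 : ℝ) + t ≠ 0 := by linarith [ht.1]
    exact_mod_cast h
  have h2 := ofReal_ne_zero_of_mem ht
  have h3 : (1 : ℂ) - 1 * (((1 - t) / (1 + t) : ℝ) : ℂ) = 2 * t / (1 + t) := by
    push_cast
    field_simp
    ring
  simp only [dlogOneSub]
  rw [h3, show (1 : ℂ) - -1 * t = 1 + t by ring]
  field_simp
  ring

theorem dlogOneSub_one_sub_div_one_add {y z : ℂ} (hy : y ≠ 1) (hz : ‖z‖ ≤ 1)
    (hyz : 1 + y = -z * (1 - y)) (ht : t ∈ Ioo (0 : ℝ) 1) :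
    2 / (1 + (t : ℂ)) ^ 2 * dlogOneSub y ((1 - t) / (1 + t))
      = dlogOneSub (-1) t - dlogOneSub z t := by
  have h1 : (1 : ℂ) + t ≠ 0 := by
    have h : (1 : ℝ) + t ≠ 0 := by linarith [ht.1]
    exact_mod_cast h
  have h2 := Complex.slitPlane_ne_zero (one_sub_mul_mem_slitPlane hz ht)
  have hy' : 1 - y ≠ 0 := sub_ne_zero.mpr hy.symm
  have h3 : (1 : ℂ) - y * (((1 - t) / (1 + t) : ℝ) : ℂ) = (1 - y) * (1 - z * t) / (1 + t) := by
    push_cast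
    field_simp
    linear_combination (t : ℂ) * hyz
  simp only [dlogOneSub]
  rw [h3, show (1 : ℂ) - -1 * t = 1 + t by ring]
  rw [div_sub_div _ _ h1 h2, div_div_eq_mul_div, div_mul_div_comm,
    div_eq_div_iff (mul_ne_zero (pow_ne_zero 2 h1) (mul_ne_zero hy' h2)) (mul_ne_zero h1 h2)]
  linear_combination -(1 - z * t) * (1 + (t : ℂ)) ^ 2 * hyz

end Substitution

section Forms

variable (l m a b c f g dA dB dC dF dG : ℂ)

/-- The form that is compared with its pullback under `t ↦ (1 - t) / (1 + t)`. -/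
noncomputable def inversionForm : ℂ :=
    (273 * f) * (b * dA)
    + (-9 / 2 * f) * (f * dA)
    + (266 * a + 9 / 2 * g) * (g * dA)
    + (-171 / 2 * b - 65 / 2 * c + 260 * f) * (a * dB)
    + (-2701 / 4 * c - 13 / 2 * m) * ((c - (l + m)) * dB)
    + (-17 * g + 1055 / 4 * l) * ((f - l) * dB)
    + (266 * b + 529 * c - 4 * g - 2125 / 4 * l - 2107 / 4 * m) * ((g - m) * dB)
    + (-1125 / 4 * m) * (b * dF)
    + (524 * a) * (b * dG)
    + (-1339 / 2 * b) * (c * dC)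
    + (489 / 2 * m) * (c * dF)
    + (-140 * c) * (c * dG)
    + (-526 * a - 475 / 2 * l) * (f * dC)
    + (c + 8 * f) * (g * dF)

/-- The form that is compared with its pullback under `t ↦ t ^ 2`. -/
noncomputable def squareForm : ℂ :=
    (-57 / 2 * a + 171 / 4 * b - 1947 / 16 * c + 27 / 8 * m) * (b * dA)
    + (-2051 / 16 * a + 266 * b) * ((c - (l + m)) * dB)
    + (-133 / 4 * a + 61 / 16 * b + 17 / 2 * c - 1075 / 8 * l - 1061 / 8 * m) * (a * dC)
    + (1105 / 4 * l + 1051 / 4 * m) * (b * dC)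
    + (-9 * b) * (c * dC)

/-- The integrand that expresses the product of a depth one and a depth two value. -/
noncomputable def stuffleForm (z z₁ u u₁ q w a dA dP dQ dU : ℂ) : ℂ :=
  (z - z₁) * w * dP + (u - u₁) * w * dP + (u - u₁) * w * dQ + -(a * w * dP)
    + -((u - u₁) * w * dA) + z₁ * (q * dU)

/-- The combination of product relations that is used. -/
noncomputable def stuffleSum : ℂ :=
  -10 * stuffleForm f l f l f c a dA dC dF dF
    + stuffleForm f l c (l + m) c g a dA dG dC dC
    - 9 * stuffleForm c (l + m) f l f g a dA dG dF dF
    + 9 * stuffleForm c (l + m) f l b c a dA dG dB dF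
    + stuffleForm g m f l g c a dA dB dG dF
    + 13 * stuffleForm g m f l b g a dA dB dB dF
    + 16 * stuffleForm g m g m g c a dA dC dG dG
    - 4 * stuffleForm g m g m c f a dA dC dC dG

/-- The integrand of the difference of the two sides of the relation. -/
noncomputable def polylogSum : ℂ :=
  46 * ((f - l) * f * dF)
    - 7 * ((c - (l + m)) * f * dB)
    - 13 * ((f - l) * g * dC)
    + 13 * -((g - m) * b * dA)
    - ((g - m) * f * dF)
    + 25 * ((g - m) * g * dG)
    - 8 * ((f - l) * b * dC)
    + 18 * -(a * g * dG)
    - 5 * -((c - (l + m)) * f * dA)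

/-- The integrand that remains after removing all relations with vanishing integral. -/
noncomputable def exactForm : ℂ :=
  polylogSum l m a b c f g dA dB dC dF dG
    - stuffleSum l m a b c f g dA dB dC dF dG
    - (45 / 16 * l + 99 / 16 * m) * (b * dA)
    - (inversionForm l m a b c f g dA dB dC dF dG
      - inversionForm l m (b - c) (l + m + a - c) (l + m - c) (l + g - c) (m + f - c)
        (dC - dB) (dC - dA) dC (dC - dG) (dC - dF))
    - (squareForm l m a b c dA dB dC
      - squareForm l m (2 * a) (b + c) (f + g) (2 * dA) (dB + dC) (dF + dG))

/-- The part of the primitive that contributes to its boundary value at `1`. -/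
noncomputable def boundaryCubic (l m c f g : ℂ) : ℂ :=
  c * (c * (-91 / 12 * c - 384 * f + 122 * g + 4125 / 8 * l + 3569 / 8 * m) + f * (1 / 2 * f
      - 10 * g + 2041 / 4 * l + 1049 / 4 * m) + g * (-9 / 2 * g + 1217 / 4 * l + 265 * m)
      - 1557 / 2 * l * l - 5495 / 4 * l * m - 3363 / 4 * m * m)
    + f * (f * (46 / 3 * f - 27 / 2 * l + 5 * m) + g * (-9 * l - m) + 140 * l * l + 280 * l * m
      + 140 * m * m)
    + g * (g * (25 / 3 * g - 8 * l - 57 / 2 * m) + 111 / 4 * l * m + 143 / 4 * m * m)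

/-- A primitive of `exactForm`. -/
noncomputable def exactPrimitive : ℂ :=
    (171 / 4 * b + 6955 / 16 * c - 4131 / 8 * f - 4131 / 8 * g - 2317 / 16 * l + 2051 / 16 * m)
      * b * a
    + (545 / 4 * c + 524 * f - 258 * l + 559 / 2 * m) * b * (c - (l + m))
    + (-9 / 2 * f + 1051 / 4 * l + 513 * m) * b * (f - l)
    + (-9 * f - 9 / 2 * g + 1105 / 4 * l + 1033 / 4 * m) * b * (g - m)
    + (133 / 4 * a - 621 / 4 * c + 4253 / 8 * f + 133 / 8 * g - 23 / 4 * l - 2247 / 4 * m) * c * a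
    + (-133 * a + 17 / 2 * f + 17 * g - 1075 / 4 * l - 1061 / 4 * m) * f * a
    + (-133 * a - 9 / 2 * g - 1075 / 4 * l + 16 * m) * g * a
    + boundaryCubic l m c f g

end Forms

theorem hasDerivAt_exactPrimitive (l m : ℂ) {a b c f g : ℝ → ℂ} {dA dB dC dF dG : ℂ} {t : ℝ}
    (ha : HasDerivAt a dA t) (hb : HasDerivAt b dB t) (hc : HasDerivAt c dC t)
    (hf : HasDerivAt f dF t) (hg : HasDerivAt g dG t) :
    HasDerivAt (fun t => exactPrimitive l m (a t) (b t) (c t) (f t) (g t))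
      (exactForm l m (a t) (b t) (c t) (f t) (g t) dA dB dC dF dG) t := by
  simp only [exactPrimitive, boundaryCubic]
  apply HasDerivAt.congr_deriv
  · repeat' first
      | exact ha | exact hb | exact hc | exact hf | exact hg
      | exact hasDerivAt_const _ _
      | apply HasDerivAt.fun_add | apply HasDerivAt.fun_sub
      | apply HasDerivAt.fun_mul
  · simp only [exactForm, polylogSum, stuffleSum, stuffleForm, inversionForm, squareForm]
    ring

/-- The value of a form in the logarithms at the point `t`. -/
noncomputable def formValue (F : ℂ → ℂ → ℂ → ℂ → ℂ → ℂ → ℂ → ℂ → ℂ → ℂ → ℂ → ℂ → ℂ) (t : ℝ) : ℂ :=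
  F (logOneSub Complex.I 1) (logOneSub (-Complex.I) 1) (logReal t) (logOneSub 1 t)
    (logOneSub (-1) t) (logOneSub Complex.I t) (logOneSub (-Complex.I) t) (1 / (t : ℂ))
    (dlogOneSub 1 t) (dlogOneSub (-1) t) (dlogOneSub Complex.I t) (dlogOneSub (-Complex.I) t)

theorem mildSingular_letters (p q r s u k : ℂ) :
    MildSingular (fun t => p * logReal t + q * logOneSub 1 t + r * logOneSub (-1) t
      + s * logOneSub Complex.I t + u * logOneSub (-Complex.I) t + k) :=
  (((((mildSingular_logReal.const_mul p).add
    ((mildSingular_logOneSub (by simp)).const_mul q)).add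
    ((mildSingular_logOneSub (by simp)).const_mul r)).add
    ((mildSingular_logOneSub (by simp)).const_mul s)).add
    ((mildSingular_logOneSub (by simp)).const_mul u)).add (mildSingular_const k)

theorem integrableOn_letters_mul {Y : ℝ → ℂ} (hY : MildSingular Y) (p q r s u k : ℂ) :
    IntegrableOn (fun t => (p * logReal t + q * logOneSub 1 t + r * logOneSub (-1) t
      + s * logOneSub Complex.I t + u * logOneSub (-Complex.I) t + k) * Y t) (Ioo 0 1) :=
  (mildSingular_letters p q r s u k).integrableOn_mul hY

theorem tendsto_letters_mul_mul {G H : ℝ → ℂ} (hG : MildSingular G) (hH : MildSingular H)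
    {L : Filter ℝ} {x : ℝ} (hL : L ≤ 𝓝 x) (hL' : Ioo 0 1 ∈ L) (hx : x * (1 - x) = 0)
    (p q r s u k : ℂ) :
    Tendsto (fun t : ℝ => (t : ℂ) * (1 - t) * ((p * logReal t + q * logOneSub 1 t
      + r * logOneSub (-1) t + s * logOneSub Complex.I t + u * logOneSub (-Complex.I) t + k)
      * G t * H t)) L (𝓝 0) :=
  (mildSingular_letters p q r s u k).tendsto_mul_mul_mul hG hH hL hL' hx

theorem mildSingular_logOneSub_mul_inv {y : ℂ} (hy : ‖y‖ ≤ 1) :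
    MildSingular (fun t => logOneSub y t * (1 / (t : ℂ))) :=
  (mildSingular_logOneSub_div hy).congr fun t _ => by ring

theorem regularArg_one : RegularArg 1 := ⟨by simp, Or.inl rfl⟩

theorem mildSingular_logReal_mul_dlogOneSub_one :
    MildSingular (fun t => logReal t * dlogOneSub 1 t) :=
  mildSingular_mul_dlogOneSub regularArg_one mildSingular_logReal mildSingular_logReal_div

theorem mildSingular_logOneSub_sub_mul_dlogOneSub_one {y : ℂ} (hy : ‖y‖ ≤ 1) (hre : y.re ≤ 0) :
    MildSingular (fun t => (logOneSub y t - logOneSub y 1) * dlogOneSub 1 t) :=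
  mildSingular_mul_dlogOneSub regularArg_one (mildSingular_logOneSub_sub hy)
    (mildSingular_logOneSub_sub_div hy hre)

theorem MildSingular.mul_dlogOneSub {f : ℝ → ℂ} (hf : MildSingular f) {y : ℂ} (hy : ‖y‖ ≤ 1)
    (hre : y.re ≤ 0) : MildSingular (fun t => f t * dlogOneSub y t) :=
  hf.mul_bounded (continuousOn_dlogOneSub hy) fun _ ht => norm_dlogOneSub_le hy hre ht.1.le

theorem integrableOn_inversionForm : IntegrableOn (formValue inversionForm) (Ioo 0 1) := by
  have h0 := integrableOn_letters_mul (mildSingular_logOneSub_mul_inv (y := 1) (by simp)) 0 0 0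
    273 0 0
  have h1 := integrableOn_letters_mul (mildSingular_logOneSub_mul_inv (y := Complex.I)
    (by simp)) 0 0 0 (-9 / 2) 0 0
  have h2 := integrableOn_letters_mul (mildSingular_logOneSub_mul_inv (y := -Complex.I)
    (by simp)) 266 0 0 0 (9 / 2) 0
  have h3 := integrableOn_letters_mul mildSingular_logReal_mul_dlogOneSub_one 0 (-171 / 2)
    (-65 / 2) 260 0 0
  have h4 := integrableOn_letters_mul (mildSingular_logOneSub_sub_mul_dlogOneSub_one (y := -1)
    (by simp) (by simp)) 0 0 (-2701 / 4) 0 0 ((-13 / 2) * logOneSub (-Complex.I) 1)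
  have h5 := integrableOn_letters_mul (mildSingular_logOneSub_sub_mul_dlogOneSub_one
    (y := Complex.I) (by simp) (by simp)) 0 0 0 0 (-17) (1055 / 4 * logOneSub Complex.I 1)
  have h6 := integrableOn_letters_mul (mildSingular_logOneSub_sub_mul_dlogOneSub_one
    (y := -Complex.I) (by simp) (by simp)) 0 266 529 0 (-4) ((-2125 / 4) * logOneSub Complex.I 1
    + (-2107 / 4) * logOneSub (-Complex.I) 1)
  have h7 := integrableOn_letters_mul ((mildSingular_logOneSub (y := 1)
    (by simp)).mul_dlogOneSub (y := Complex.I) (by simp) (by simp)) 0 0 0 0 0 ((-1125 / 4)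
    * logOneSub (-Complex.I) 1)
  have h8 := integrableOn_letters_mul ((mildSingular_logOneSub (y := 1)
    (by simp)).mul_dlogOneSub (y := -Complex.I) (by simp) (by simp)) 524 0 0 0 0 0
  have h9 := integrableOn_letters_mul ((mildSingular_logOneSub (y := -1)
    (by simp)).mul_dlogOneSub (y := -1) (by simp) (by simp)) 0 (-1339 / 2) 0 0 0 0
  have h10 := integrableOn_letters_mul ((mildSingular_logOneSub (y := -1)
    (by simp)).mul_dlogOneSub (y := Complex.I) (by simp) (by simp)) 0 0 0 0 0 (489 / 2 * logOneSub
    (-Complex.I) 1)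
  have h11 := integrableOn_letters_mul ((mildSingular_logOneSub (y := -1)
    (by simp)).mul_dlogOneSub (y := -Complex.I) (by simp) (by simp)) 0 0 (-140) 0 0 0
  have h12 := integrableOn_letters_mul ((mildSingular_logOneSub (y := Complex.I)
    (by simp)).mul_dlogOneSub (y := -1) (by simp) (by simp)) (-526) 0 0 0 0 ((-475 / 2)
    * logOneSub Complex.I 1)
  have h13 := integrableOn_letters_mul ((mildSingular_logOneSub (y := -Complex.I)
    (by simp)).mul_dlogOneSub (y := Complex.I) (by simp) (by simp)) 0 0 1 8 0 0
  refine IntegrableOn.congr_fun (((((((((((((h0.add h1).add h2).add h3).add h4).add h5).add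
    h6).add h7).add h8).add h9).add h10).add h11).add h12).add h13) (fun t _ => ?_)
    measurableSet_Ioo
  simp only [Pi.add_apply, formValue, inversionForm, logOneSub_neg_one_one]
  ring

theorem integrableOn_squareForm :
    IntegrableOn (fun t => squareForm (logOneSub Complex.I 1) (logOneSub (-Complex.I) 1) (logReal t)
      (logOneSub 1 t) (logOneSub (-1) t) (1 / (t : ℂ)) (dlogOneSub 1 t) (dlogOneSub (-1) t))
      (Ioo 0 1) := by
  have h0 := integrableOn_letters_mul (mildSingular_logOneSub_mul_inv (y := 1) (by simp))
    (-57 / 2) (171 / 4) (-1947 / 16) 0 0 (27 / 8 * logOneSub (-Complex.I) 1)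
  have h1 := integrableOn_letters_mul (mildSingular_logOneSub_sub_mul_dlogOneSub_one (y := -1)
    (by simp) (by simp)) (-2051 / 16) 266 0 0 0 0
  have h2 := integrableOn_letters_mul (mildSingular_logReal.mul_dlogOneSub (y := -1) (by simp)
    (by simp)) (-133 / 4) (61 / 16) (17 / 2) 0 0 ((-1075 / 8) * logOneSub Complex.I 1
    + (-1061 / 8) * logOneSub (-Complex.I) 1)
  have h3 := integrableOn_letters_mul ((mildSingular_logOneSub (y := 1)
    (by simp)).mul_dlogOneSub (y := -1) (by simp) (by simp)) 0 0 0 0 0 (1105 / 4 * logOneSub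
    Complex.I 1 + 1051 / 4 * logOneSub (-Complex.I) 1)
  have h4 := integrableOn_letters_mul ((mildSingular_logOneSub (y := -1)
    (by simp)).mul_dlogOneSub (y := -1) (by simp) (by simp)) 0 (-9) 0 0 0 0
  refine IntegrableOn.congr_fun ((((h0.add h1).add h2).add h3).add h4) (fun t _ => ?_)
    measurableSet_Ioo
  simp only [Pi.add_apply, squareForm, logOneSub_neg_one_one]
  ring

theorem mul_inversionForm (x l m a b c f g dA dB dC dF dG : ℂ) :
    x * inversionForm l m a b c f g dA dB dC dF dG
      = inversionForm l m a b c f g (x * dA) (x * dB) (x * dC) (x * dF) (x * dG) := by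
  simp only [inversionForm]
  ring

theorem mul_squareForm (x l m a b c dA dB dC : ℂ) :
    x * squareForm l m a b c dA dB dC
      = squareForm l m a b c (x * dA) (x * dB) (x * dC) := by
  simp only [squareForm]
  ring

theorem hasUnitIntegral_inversionForm_pullback {v : ℂ}
    (h : HasUnitIntegral (formValue inversionForm) v) :
    HasUnitIntegral (formValue fun l m a b c f g dA dB dC dF dG =>
      inversionForm l m (b - c) (l + m + a - c) (l + m - c) (l + g - c) (m + f - c)
        (dC - dB) (dC - dA) dC (dC - dG) (dC - dF)) v := by
  refine h.comp_one_sub_div_one_add.congr fun t ht => ?_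
  have hI := Complex.I_sq
  have h0 : logOneSub 0 t = 0 := by simp [logOneSub]
  have h0' : dlogOneSub 0 t = 0 := by simp [dlogOneSub]
  have hne : Complex.I ≠ 1 := fun h => by simpa using congrArg Complex.re h
  have hne' : -Complex.I ≠ 1 := fun h => by simpa using congrArg Complex.re h
  simp only [formValue]
  rw [mul_inversionForm, logReal_one_sub_div_one_add ht, logOneSub_one_one_sub_div_one_add ht,
    logOneSub_one_sub_div_one_add (y := -1) (z := 0) (by simp) (by simp) (by simp) (by simp) ht,
    logOneSub_one_sub_div_one_add (y := Complex.I) (z := -Complex.I) (by simp) (by simp) (by simp)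
      (by linear_combination hI) ht,
    logOneSub_one_sub_div_one_add (y := -Complex.I) (z := Complex.I) (by simp) (by simp) (by simp)
      (by linear_combination hI) ht,
    inv_one_sub_div_one_add ht, dlogOneSub_one_one_sub_div_one_add ht,
    dlogOneSub_one_sub_div_one_add (y := -1) (z := 0) (by norm_num) (by simp) (by simp) ht,
    dlogOneSub_one_sub_div_one_add (y := Complex.I) (z := -Complex.I) hne (by simp)
      (by linear_combination hI) ht,
    dlogOneSub_one_sub_div_one_add (y := -Complex.I) (z := Complex.I) hne' (by simp)
      (by linear_combination hI) ht, logOneSub_neg_one_one, h0, h0', add_zero, sub_zero]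

theorem hasUnitIntegral_squareForm_pullback {v : ℂ}
    (h : HasUnitIntegral (fun t => squareForm (logOneSub Complex.I 1)
      (logOneSub (-Complex.I) 1) (logReal t)
      (logOneSub 1 t) (logOneSub (-1) t) (1 / (t : ℂ)) (dlogOneSub 1 t) (dlogOneSub (-1) t)) v) :
    HasUnitIntegral (formValue fun l m a b c f g dA dB dC dF dG =>
      squareForm l m (2 * a) (b + c) (f + g) (2 * dA) (dB + dC) (dF + dG)) v := by
  refine h.comp_sq.congr fun t ht => ?_
  have h0 := ofReal_ne_zero_of_mem ht
  have h1 : 2 * (t : ℂ) * (1 / ((t ^ 2 : ℝ) : ℂ)) = 2 * (1 / t) := by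
    push_cast
    field_simp
  simp only [formValue]
  rw [mul_squareForm, h1, logReal_sq, logOneSub_sq (z := 1) (by simp) (by simp) ht,
    logOneSub_sq (z := Complex.I) (by simp) (by simp) ht,
    dlogOneSub_sq (z := 1) (by simp) (by simp) ht,
    dlogOneSub_sq (z := Complex.I) (by simp) (by simp) ht]

/-- Nonzero arguments of norm at most one with nonpositive real part. -/
def IsLetter (y : ℂ) : Prop := ‖y‖ ≤ 1 ∧ y.re ≤ 0 ∧ y ≠ 0

theorem isLetter_I : IsLetter Complex.I := ⟨by simp, by simp, by simp⟩

theorem isLetter_neg_I : IsLetter (-Complex.I) := ⟨by simp, by simp, by simp⟩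

theorem isLetter_neg_one : IsLetter (-1) := ⟨by simp, by simp, by simp⟩

theorem IsLetter.regularArg {y : ℂ} (hy : IsLetter y) : RegularArg y := ⟨hy.1, Or.inr hy.2.1⟩

theorem hasUnitIntegral_stuffleForm {z u : ℂ} (v : ℂ) {p q w : ℂ} (hz : IsLetter z)
    (hu : IsLetter u) (hp : RegularArg p) (hq : RegularArg q) (hv : ‖v‖ ≤ 1) (hpe : z * u = p)
    (hqe : u * v = q) (hwe : z * u * v = w) :
    HasUnitIntegral (fun t => stuffleForm (logOneSub z t) (logOneSub z 1) (logOneSub u t)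
      (logOneSub u 1) (logOneSub q t) (logOneSub w t) (logReal t) (1 / (t : ℂ)) (dlogOneSub p t)
      (dlogOneSub q t) (dlogOneSub u t)) 0 :=
  hasUnitIntegral_stuffle hz.1 hz.2.1 hu.1 hu.2.1 hu.2.2 hv hp hq hpe hqe hwe

theorem hasUnitIntegral_Li_one_one_one_of_eq {z₁ z₂ z₃ p w : ℂ} (h₁ : IsLetter z₁)
    (hp : RegularArg p) (h₂ : ‖z₂‖ ≤ 1) (h₃ : ‖z₃‖ ≤ 1) (hpe : z₁ * z₂ = p)
    (hwe : z₁ * z₂ * z₃ = w) :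
    HasUnitIntegral (fun t => (logOneSub z₁ t - logOneSub z₁ 1) * logOneSub w t * dlogOneSub p t)
      (Li [(1, z₁), (1, z₂), (1, z₃)]) := by
  subst hpe hwe
  exact hasUnitIntegral_Li_one_one_one h₁.1 h₁.2.1 h₃ h₂ hp

theorem hasUnitIntegral_Li_one_two_of_eq {z₁ z₂ w : ℂ} (h₁ : IsLetter z₁) (h₂ : ‖z₂‖ ≤ 1)
    (hwe : z₁ * z₂ = w) :
    HasUnitIntegral (fun t => -((logOneSub z₁ t - logOneSub z₁ 1) * logOneSub w t *
      (1 / (t : ℂ)))) (Li [(1, z₁), (2, z₂)]) := by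
  subst hwe
  exact hasUnitIntegral_Li_one_two h₁.1 h₁.2.2 h₁.2.1 h₂

theorem hasUnitIntegral_Li_two_one_of_eq {z₁ z₂ w : ℂ} (h₁ : RegularArg z₁) (h₂ : ‖z₂‖ ≤ 1)
    (hwe : z₁ * z₂ = w) :
    HasUnitIntegral (fun t => -(logReal t * logOneSub w t * dlogOneSub z₁ t))
      (Li [(2, z₁), (1, z₂)]) := by
  subst hwe
  exact hasUnitIntegral_Li_two_one h₁ h₂

theorem hasUnitIntegral_stuffleSum : HasUnitIntegral (formValue stuffleSum) 0 := by
  have h0 := hasUnitIntegral_stuffleForm (w := -1) 1 isLetter_I isLetter_I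
    isLetter_neg_one.regularArg isLetter_I.regularArg (by simp) (by simp) (by simp) (by simp)
  have h1 := hasUnitIntegral_stuffleForm (w := -Complex.I) 1 isLetter_I isLetter_neg_one
    isLetter_neg_I.regularArg isLetter_neg_one.regularArg (by simp) (by simp) (by simp) (by simp)
  have h2 := hasUnitIntegral_stuffleForm (w := -Complex.I) 1 isLetter_neg_one isLetter_I
    isLetter_neg_I.regularArg isLetter_I.regularArg (by simp) (by simp) (by simp) (by simp)
  have h3 := hasUnitIntegral_stuffleForm (w := -1) (-Complex.I) isLetter_neg_one isLetter_I
    isLetter_neg_I.regularArg regularArg_one (by simp) (by simp) (by simp) (by simp)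
  have h4 := hasUnitIntegral_stuffleForm (w := -1) (-1) isLetter_neg_I isLetter_I regularArg_one
    isLetter_neg_I.regularArg (by simp) (by simp) (by simp) (by simp)
  have h5 := hasUnitIntegral_stuffleForm (w := -Complex.I) (-Complex.I) isLetter_neg_I
    isLetter_I regularArg_one regularArg_one (by simp) (by simp) (by simp) (by simp)
  have h6 := hasUnitIntegral_stuffleForm (w := -1) 1 isLetter_neg_I isLetter_neg_I
    isLetter_neg_one.regularArg isLetter_neg_I.regularArg (by simp) (by simp) (by simp) (by simp)
  have h7 := hasUnitIntegral_stuffleForm (w := Complex.I) (-Complex.I) isLetter_neg_I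
    isLetter_neg_I isLetter_neg_one.regularArg isLetter_neg_one.regularArg (by simp) (by simp)
    (by simp) (by simp)
  have h :=
    (((((((h0.const_mul (-10)).add (h1.const_mul 1)).add (h2.const_mul (-9))).add (h3.const_mul
    9)).add (h4.const_mul 1)).add (h5.const_mul 13)).add (h6.const_mul 16)).add (h7.const_mul
    (-4))
  simp only [mul_zero, add_zero] at h
  refine h.congr fun t _ => ?_
  simp only [formValue, stuffleSum, logOneSub_neg_one_one]
  ring

theorem hasUnitIntegral_polylogSum :
    HasUnitIntegral (formValue polylogSum)
      (46 * Li [(1, Complex.I), (1, 1), (1, 1)]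
        - 7 * Li [(1, -1), (1, -1), (1, Complex.I)]
        - 13 * Li [(1, Complex.I), (1, Complex.I), (1, Complex.I)]
        + 13 * Li [(1, -Complex.I), (2, Complex.I)]
        - Li [(1, -Complex.I), (1, -1), (1, 1)]
        + 25 * Li [(1, -Complex.I), (1, 1), (1, 1)]
        - 8 * Li [(1, Complex.I), (1, Complex.I), (1, -1)]
        + 18 * Li [(2, -Complex.I), (1, 1)]
        - 5 * Li [(1, -1), (2, -Complex.I)]) := by
  have h0 := hasUnitIntegral_Li_one_one_one_of_eq (z₂ := 1) (z₃ := 1) (w := Complex.I)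
    isLetter_I isLetter_I.regularArg (by simp) (by simp) (by simp) (by simp)
  have h1 := hasUnitIntegral_Li_one_one_one_of_eq (z₂ := -1) (z₃ := Complex.I) (w := Complex.I)
    isLetter_neg_one regularArg_one (by simp) (by simp) (by simp) (by simp)
  have h2 := hasUnitIntegral_Li_one_one_one_of_eq (z₂ := Complex.I) (z₃ := Complex.I) (w :=
    -Complex.I) isLetter_I isLetter_neg_one.regularArg (by simp) (by simp) (by simp) (by simp)
  have h3 := hasUnitIntegral_Li_one_two_of_eq (z₂ := Complex.I) (w := 1) isLetter_neg_I
    (by simp) (by simp)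
  have h4 := hasUnitIntegral_Li_one_one_one_of_eq (z₂ := -1) (z₃ := 1) (w := Complex.I)
    isLetter_neg_I isLetter_I.regularArg (by simp) (by simp) (by simp) (by simp)
  have h5 := hasUnitIntegral_Li_one_one_one_of_eq (z₂ := 1) (z₃ := 1) (w := -Complex.I)
    isLetter_neg_I isLetter_neg_I.regularArg (by simp) (by simp) (by simp) (by simp)
  have h6 := hasUnitIntegral_Li_one_one_one_of_eq (z₂ := Complex.I) (z₃ := -1) (w := 1)
    isLetter_I isLetter_neg_one.regularArg (by simp) (by simp) (by simp) (by simp)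
  have h7 := hasUnitIntegral_Li_two_one_of_eq (z₂ := 1) (w := -Complex.I)
    isLetter_neg_I.regularArg (by simp) (by simp)
  have h8 := hasUnitIntegral_Li_one_two_of_eq (z₂ := -Complex.I) (w := Complex.I)
    isLetter_neg_one (by simp) (by simp)
  have h :=
    ((((((((h0.const_mul 46).add (h1.const_mul (-7))).add (h2.const_mul (-13))).add (h3.const_mul
    13)).add (h4.const_mul (-1))).add (h5.const_mul 25)).add (h6.const_mul (-8))).add
    (h7.const_mul 18)).add (h8.const_mul (-5))
  convert h.congr (g := formValue polylogSum) fun t _ => ?_ using 1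
  · ring
  · simp only [formValue, polylogSum, logOneSub_neg_one_one]
    ring

theorem hasUnitIntegral_exactForm {v : ℂ} (h : HasUnitIntegral (formValue polylogSum) v) :
    HasUnitIntegral (formValue exactForm) (v + (45 / 16 * logOneSub Complex.I 1
      + 99 / 16 * logOneSub (-Complex.I) 1) * ((Real.pi : ℂ) ^ 2 / 6)) := by
  have h1 : HasUnitIntegral (formValue inversionForm) _ := ⟨integrableOn_inversionForm, rfl⟩
  have h2 : HasUnitIntegral _ _ := ⟨integrableOn_squareForm, rfl⟩
  have h3 := hasUnitIntegral_log_one_sub_div.const_mul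
    (45 / 16 * logOneSub Complex.I 1 + 99 / 16 * logOneSub (-Complex.I) 1)
  have h4 := (((h.sub hasUnitIntegral_stuffleSum).sub h3).sub
    (h1.sub (hasUnitIntegral_inversionForm_pullback h1))).sub
    (h2.sub (hasUnitIntegral_squareForm_pullback h2))
  convert h4 using 1
  · funext t
    simp only [formValue, exactForm]
  · ring

theorem tendsto_exactPrimitive {L : Filter ℝ} {x : ℝ} (hL : L ≤ 𝓝 x) (hL' : Ioo 0 1 ∈ L)
    (hx : x * (1 - x) = 0) {c f g : ℂ} (hc : Tendsto (logOneSub (-1)) L (𝓝 c))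
    (hf : Tendsto (logOneSub Complex.I) L (𝓝 f)) (hg : Tendsto (logOneSub (-Complex.I)) L (𝓝 g)) :
    Tendsto (fun t => exactPrimitive (logOneSub Complex.I 1) (logOneSub (-Complex.I) 1) (logReal t)
      (logOneSub 1 t) (logOneSub (-1) t) (logOneSub Complex.I t) (logOneSub (-Complex.I) t))
      L (𝓝 (boundaryCubic (logOneSub Complex.I 1) (logOneSub (-Complex.I) 1) c f g)) := by
  have h0 := tendsto_letters_mul_mul (mildSingular_logOneSub_div (y := 1) (by simp))
    mildSingular_logReal_div hL hL' hx 0 (171 / 4) (6955 / 16) (-4131 / 8) (-4131 / 8)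
    ((-2317 / 16) * logOneSub Complex.I 1 + 2051 / 16 * logOneSub (-Complex.I) 1)
  have h1 := tendsto_letters_mul_mul (mildSingular_logOneSub_div (y := 1) (by simp))
    (mildSingular_logOneSub_sub_div (y := -1) (by simp) (by simp)) hL hL' hx 0 0 (545 / 4) 524 0
    ((-258) * logOneSub Complex.I 1 + 559 / 2 * logOneSub (-Complex.I) 1)
  have h2 := tendsto_letters_mul_mul (mildSingular_logOneSub_div (y := 1) (by simp))
    (mildSingular_logOneSub_sub_div (y := Complex.I) (by simp) (by simp)) hL hL' hx 0 0 0 (-9 / 2)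
    0 (1051 / 4 * logOneSub Complex.I 1 + 513 * logOneSub (-Complex.I) 1)
  have h3 := tendsto_letters_mul_mul (mildSingular_logOneSub_div (y := 1) (by simp))
    (mildSingular_logOneSub_sub_div (y := -Complex.I) (by simp) (by simp)) hL hL' hx 0 0 0 (-9)
    (-9 / 2) (1105 / 4 * logOneSub Complex.I 1 + 1033 / 4 * logOneSub (-Complex.I) 1)
  have h4 := tendsto_letters_mul_mul (mildSingular_logOneSub_div (y := -1) (by simp))
    mildSingular_logReal_div hL hL' hx (133 / 4) 0 (-621 / 4) (4253 / 8) (133 / 8) ((-23 / 4)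
    * logOneSub Complex.I 1 + (-2247 / 4) * logOneSub (-Complex.I) 1)
  have h5 := tendsto_letters_mul_mul (mildSingular_logOneSub_div (y := Complex.I) (by simp))
    mildSingular_logReal_div hL hL' hx (-133) 0 0 (17 / 2) 17 ((-1075 / 4) * logOneSub Complex.I 1
    + (-1061 / 4) * logOneSub (-Complex.I) 1)
  have h6 := tendsto_letters_mul_mul (mildSingular_logOneSub_div (y := -Complex.I) (by simp))
    mildSingular_logReal_div hL hL' hx (-133) 0 0 0 (-9 / 2) ((-1075 / 4) * logOneSub Complex.I 1
    + 16 * logOneSub (-Complex.I) 1)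
  have hQ : Continuous fun p : ℂ × ℂ × ℂ => boundaryCubic (logOneSub Complex.I 1)
      (logOneSub (-Complex.I) 1) p.1 p.2.1 p.2.2 := by
    unfold boundaryCubic
    fun_prop
  have h :=
    ((((((h0.add h1).add h2).add h3).add h4).add h5).add h6).add ((hQ.tendsto (c, f, g)).comp
    (hc.prodMk_nhds (hf.prodMk_nhds hg)))
  simp only [add_zero, zero_add] at h
  refine h.congr' ?_
  filter_upwards [hL'] with t ht
  have ht0 := ofReal_ne_zero_of_mem ht
  have ht1 := one_sub_ofReal_ne_zero_of_mem ht
  simp only [exactPrimitive, logOneSub_neg_one_one, Function.comp_apply]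
  field_simp
  ring

theorem hasUnitIntegral_exactForm_boundary (h : IntegrableOn (formValue exactForm) (Ioo 0 1)) :
    HasUnitIntegral (formValue exactForm) (boundaryCubic (logOneSub Complex.I 1)
      (logOneSub (-Complex.I) 1) (logOneSub (-1) 1) (logOneSub Complex.I 1)
      (logOneSub (-Complex.I) 1)) := by
  have h0 := tendsto_exactPrimitive (L := 𝓝[>] 0) nhdsWithin_le_nhds
    (Ioo_mem_nhdsGT one_pos) (by simp) tendsto_logOneSub_zero tendsto_logOneSub_zero
    tendsto_logOneSub_zero
  have h1 := tendsto_exactPrimitive (L := 𝓝[<] 1) nhdsWithin_le_nhds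
    (Ioo_mem_nhdsLT one_pos) (by simp) (tendsto_logOneSub_one (by simp))
    (tendsto_logOneSub_one (by simp)) (tendsto_logOneSub_one (by simp))
  have h2 := hasUnitIntegral_of_hasDerivAt h (fun t ht => hasDerivAt_exactPrimitive _ _
    (hasDerivAt_logReal ht) (hasDerivAt_logOneSub (by simp) ht) (hasDerivAt_logOneSub (by simp) ht)
    (hasDerivAt_logOneSub (by simp) ht) (hasDerivAt_logOneSub (by simp) ht)) h0 h1
  convert h2 using 1
  simp [boundaryCubic]

end

open Complex in
/-- the `ℚ`-linear relation
`5·Li_{1,2}(−1,−i) = 46·Li_{1,1,1}(i,1,1) − 7·Li_{1,1,1}(−1,−1,i) − 13·Li_{1,1,1}(i,i,i)`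
`+ 13·Li_{1,2}(−i,i) − Li_{1,1,1}(−i,−1,1) + 25·Li_{1,1,1}(−i,1,1) − 8·Li_{1,1,1}(i,i,−1)`
`+ 18·Li_{2,1}(−i,1)` among weight-3 multiple polylogarithm values at 4th roots of unity. -/
theorem mpv_octahedral_relation_weight3_level4 :
    5 * Li [(1, -1), (2, -I)] =
      46 * Li [(1, I), (1, 1), (1, 1)]
      - 7 * Li [(1, -1), (1, -1), (1, I)]
      - 13 * Li [(1, I), (1, I), (1, I)]
      + 13 * Li [(1, -I), (2, I)]
      - Li [(1, -I), (1, -1), (1, 1)]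
      + 25 * Li [(1, -I), (1, 1), (1, 1)]
      - 8 * Li [(1, I), (1, I), (1, -1)]
      + 18 * Li [(2, -I), (1, 1)] := by
  have h1 := hasUnitIntegral_exactForm hasUnitIntegral_polylogSum
  have h2 := h1.unique (hasUnitIntegral_exactForm_boundary h1.1)
  rw [boundaryCubic, logOneSub_neg_one_one] at h2
  linear_combination -h2 + 2 / 3 * (45 / 16 * logOneSub I 1 + 99 / 16 * logOneSub (-I) 1)
    * logOneSub_I_one_sub_sq
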